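/- Let n ≥ 3 and let φ : Mₙ(ℂ) → Mₙ(ℂ) be a map whose range contains every nonzero idempotent and every anti-idempotent matrix. Suppose that for all A, B ∈ Mₙ(ℂ), A∘B is idempotent if and only if φ(A)∘φ(B) is idempotent. Then there exist a field automorphism σ of ℂ, an invertible matrix T ∈ Mₙ(ℂ), and λ ∈ {1, −1} such that either φ([x_{ij}]) = λ·T [σ(x_{ij})] T⁻¹ for all [x_{ij}] ∈ Mₙ(ℂ), or φ([x_{ij}]) = λ·T [σ(x_{ij})]ᵗ T⁻¹ for all [x_{ij}] ∈ Mₙ(ℂ), where [σ(x_{ij})] is the matrix obtained by applying σ entrywise and ᵗ denotes transposition. -/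

import Mathlib

open Matrix

set_option linter.unusedSimpArgs false
set_option linter.unusedVariables false

namespace JP

variable {n : ℕ}

abbrev Mt (n : ℕ) := Matrix (Fin n) (Fin n) ℂ
abbrev Vc (n : ℕ) := Fin n → ℂ

/-- rank one matrix -/
abbrev ro (x f : Vc n) : Mt n := vecMulVec x f

lemma ro_mulVec (x f v : Vc n) : (ro x f) *ᵥ v = (f ⬝ᵥ v) • x := by
  rw [vecMulVec_mulVec]; ext i; simp [mul_comm]

lemma vecMul_ro (x f v : Vc n) : v ᵥ* (ro x f) = (v ⬝ᵥ x) • f := vecMul_vecMulVec _ _ _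

lemma mul_ro (A : Mt n) (x f : Vc n) : A * ro x f = ro (A *ᵥ x) f := mul_vecMulVec _ _ _
lemma ro_mul (A : Mt n) (x f : Vc n) : ro x f * A = ro x (f ᵥ* A) := vecMulVec_mul _ _ _
lemma ro_mul_ro (x f y g : Vc n) : ro x f * ro y g = (f ⬝ᵥ y) • ro x g := by
  rw [vecMulVec_mul_vecMulVec, vecMulVec_smul]
lemma vm_dot (f : Vc n) (A : Mt n) (v : Vc n) : (f ᵥ* A) ⬝ᵥ v = f ⬝ᵥ (A *ᵥ v) :=
  (dotProduct_mulVec f A v).symm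

lemma mat_ext {A B : Mt n} (h : ∀ v, A *ᵥ v = B *ᵥ v) : A = B :=
  Matrix.ext_of_mulVec_single fun _ => h _

lemma mat_ext' {A B : Mt n} (h : ∀ v, v ᵥ* A = v ᵥ* B) : A = B :=
  Matrix.ext_of_single_vecMul fun _ => h _

lemma vec_ext {x y : Vc n} (h : ∀ f : Vc n, f ⬝ᵥ x = f ⬝ᵥ y) : x = y := by
  ext i; simpa using h (Pi.single i 1)

lemma vec_ext' {x y : Vc n} (h : ∀ f : Vc n, x ⬝ᵥ f = y ⬝ᵥ f) : x = y := by
  ext i; simpa using h (Pi.single i 1)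

lemma exists_dual (W : Submodule ℂ (Vc n)) {v : Vc n} (hv : v ∉ W) :
    ∃ f : Vc n, (∀ w ∈ W, f ⬝ᵥ w = 0) ∧ f ⬝ᵥ v = 1 := by
  obtain ⟨f, hf, hW⟩ := Submodule.exists_le_ker_of_notMem hv
  have key : ∀ w, (fun i => f (Pi.single i 1)) ⬝ᵥ w = f w := by
    intro w
    conv_rhs => rw [pi_eq_sum_univ' w]
    simp only [dotProduct, map_sum]
    refine Finset.sum_congr rfl fun i _ => ?_
    rw [map_smul, smul_eq_mul, mul_comm]
  refine ⟨(f v)⁻¹ • fun i => f (Pi.single i 1), fun w hw => ?_, ?_⟩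
  · rw [smul_dotProduct, key, show f w = 0 from hW hw, smul_zero]
  · rw [smul_dotProduct, key, smul_eq_mul, inv_mul_cancel₀ hf]

lemma exists_dual1 {v : Vc n} (hv : v ≠ 0) : ∃ f : Vc n, f ⬝ᵥ v = 1 := by
  obtain ⟨f, -, h⟩ := exists_dual (⊥ : Submodule ℂ (Vc n)) (v := v) (by simpa using hv)
  exact ⟨f, h⟩

lemma exists_dual1' {v : Vc n} (hv : v ≠ 0) : ∃ f : Vc n, v ⬝ᵥ f = 1 := by
  obtain ⟨f, h⟩ := exists_dual1 hv
  exact ⟨f, by rw [dotProduct_comm, h]⟩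

lemma exists_dual2 {x y : Vc n} (hx : x ≠ 0) (hy : ∀ c : ℂ, y ≠ c • x) (a b : ℂ) :
    ∃ f : Vc n, f ⬝ᵥ x = a ∧ f ⬝ᵥ y = b := by
  obtain ⟨g, hg⟩ := exists_dual1 hx
  obtain ⟨f, hf, hf1⟩ := exists_dual (Submodule.span ℂ {x}) (v := y) (by
    rw [Submodule.mem_span_singleton]; rintro ⟨c, hc⟩; exact hy c hc.symm)
  have hf0 := hf x (Submodule.mem_span_singleton_self x)
  refine ⟨a • g + (b - a * (g ⬝ᵥ y)) • f, ?_, ?_⟩ <;>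
    simp [add_dotProduct, smul_dotProduct, hg, hf0, hf1]

lemma exists_dual2' {x y : Vc n} (hx : x ≠ 0) (hy : ∀ c : ℂ, y ≠ c • x) (a b : ℂ) :
    ∃ f : Vc n, x ⬝ᵥ f = a ∧ y ⬝ᵥ f = b := by
  obtain ⟨f, h1, h2⟩ := exists_dual2 hx hy a b
  exact ⟨f, by rw [dotProduct_comm, h1], by rw [dotProduct_comm, h2]⟩

/-- idempotency of Jordan product -/
def Rel (A B : Mt n) : Prop := (A * B + B * A) * (A * B + B * A) = (2 : ℂ) • (A * B + B * A)

lemma rel_iff (A B : Mt n) :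
    IsIdempotentElem ((2⁻¹ : ℂ) • (A * B + B * A)) ↔ Rel A B := by
  unfold IsIdempotentElem Rel
  rw [smul_mul_smul_comm]
  constructor
  · intro h
    have := congrArg (fun X => (4 : ℂ) • X) h
    simp only [smul_smul] at this
    norm_num at this; rw [this, smul_add]
  · intro h
    rw [h, smul_smul]; norm_num

lemma Rel.comm {A B : Mt n} : Rel A B ↔ Rel B A := by
  unfold Rel; rw [add_comm (A * B)]

lemma rel_one {A : Mt n} : Rel A 1 ↔ A * A = A := by
  unfold Rel
  simp only [mul_one, one_mul, ← two_smul ℂ A]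
  rw [smul_mul_smul_comm, smul_smul]
  constructor
  · intro h
    have := congrArg (fun X => (4⁻¹ : ℂ) • X) h
    simp only [smul_smul] at this
    norm_num at this; exact this
  · intro h; rw [h]

lemma rel_neg_right {A B : Mt n} : Rel A (-B) ↔ Rel (-A) B := by
  unfold Rel; simp

lemma rel_neg_neg {A B : Mt n} : Rel (-A) (-B) ↔ Rel A B := by
  rw [rel_neg_right, neg_neg]

lemma rel_transpose {A B : Mt n} : Rel Aᵀ Bᵀ ↔ Rel A B := by
  unfold Rel
  rw [← transpose_mul, ← transpose_mul, ← transpose_add, ← transpose_mul, ← transpose_smul,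
    transpose_inj, add_comm]

/-- zero Jordan product iff related to all multiples -/
lemma rel_smul_iff {A B : Mt n} (c : ℂ) (hc : c ≠ 0) : Rel A (c • B) ↔
    c • ((A * B + B * A) * (A * B + B * A)) = (2 : ℂ) • (A * B + B * A) := by
  unfold Rel
  simp only [mul_smul_comm, smul_mul_assoc, ← smul_add, smul_smul]
  constructor
  · intro h
    have := congrArg (fun X => (c⁻¹ : ℂ) • X) h
    simp only [smul_smul] at this
    field_simp at this
    exact this
  · intro h
    have := congrArg (fun X => c • X) h
    simp only [smul_smul] at this
    rw [this, mul_comm]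

lemma rel_pm {A B : Mt n} (h1 : Rel A B) (h2 : Rel A (-B)) : A * B + B * A = 0 := by
  unfold Rel at h1 h2
  have e : A * -B + -B * A = -(A * B + B * A) := by noncomm_ring
  rw [e, neg_mul_neg, h1, smul_neg, ← sub_eq_zero, sub_neg_eq_add, ← add_smul] at h2
  exact (smul_eq_zero.1 h2).resolve_left (by norm_num)

lemma rel_of_zero {A B : Mt n} (h : A * B + B * A = 0) : Rel A B := by
  unfold Rel; rw [h]; simp

lemma rel_two {A B : Mt n} {c d : ℂ} (hc : c ≠ 0) (hd : d ≠ 0) (hcd : c ≠ d)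
    (h1 : Rel A (c • B)) (h2 : Rel A (d • B)) : A * B + B * A = 0 := by
  rw [rel_smul_iff c hc] at h1
  rw [rel_smul_iff d hd] at h2
  have : (c - d) • ((A * B + B * A) * (A * B + B * A)) = 0 := by
    rw [sub_smul, h1, h2, sub_self]
  have h0 := (smul_eq_zero.1 this).resolve_left (sub_ne_zero.2 hcd)
  rw [h0, smul_zero] at h1
  exact (smul_eq_zero.1 h1.symm).resolve_left (by norm_num)

lemma rel_smul_of_zero {A B : Mt n} (c : ℂ) (h : A * B + B * A = 0) : Rel A (c • B) := by
  apply rel_of_zero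
  rw [mul_smul_comm, smul_mul_assoc, ← smul_add, h, smul_zero]

lemma ro_smul_left (c : ℂ) (x f : Vc n) : ro (c • x) f = c • ro x f := smul_vecMulVec _ _ _
lemma ro_smul_right (c : ℂ) (x f : Vc n) : ro x (c • f) = c • ro x f := vecMulVec_smul _ _ _
lemma ro_add_left (x y f : Vc n) : ro (x + y) f = ro x f + ro y f := add_vecMulVec _ _ _
lemma ro_add_right (x f g : Vc n) : ro x (f + g) = ro x f + ro x g := vecMulVec_add _ _ _
lemma ro_sub_left (x y f : Vc n) : ro (x - y) f = ro x f - ro y f := sub_vecMulVec _ _ _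
lemma ro_sub_right (x f g : Vc n) : ro x (f - g) = ro x f - ro x g := vecMulVec_sub _ _ _
lemma ro_neg_left (x f : Vc n) : ro (-x) f = -ro x f := neg_vecMulVec _ _
lemma ro_neg_right (x f : Vc n) : ro x (-f) = -ro x f := vecMulVec_neg _ _
lemma ro_transpose (x f : Vc n) : (ro x f)ᵀ = ro f x := transpose_vecMulVec _ _
lemma ro_eq_zero {x f : Vc n} : ro x f = 0 ↔ x = 0 ∨ f = 0 := vecMulVec_eq_zero

lemma ro_inj_right {x f g : Vc n} (hx : x ≠ 0) (h : ro x f = ro x g) : f = g := by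
  have : ro x (f - g) = 0 := by rw [ro_sub_right, h, sub_self]
  exact sub_eq_zero.1 ((ro_eq_zero.1 this).resolve_left hx)

lemma ro_inj_left {x y f : Vc n} (hf : f ≠ 0) (h : ro x f = ro y f) : x = y := by
  have : ro (x - y) f = 0 := by rw [ro_sub_left, h, sub_self]
  exact sub_eq_zero.1 ((ro_eq_zero.1 this).resolve_right hf)

/-- a rank one relation: `u ⊗ f + x ⊗ v = 0` -/
lemma ro_idem {x f : Vc n} (h : f ⬝ᵥ x = 1) : ro x f * ro x f = ro x f := by
  rw [ro_mul_ro, h, one_smul]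

lemma ne_zero_of_dot {x f : Vc n} {c : ℂ} (hc : c ≠ 0) (h : f ⬝ᵥ x = c) : x ≠ 0 ∧ f ≠ 0 := by
  constructor <;> rintro rfl <;> simp at h <;> exact hc h.symm

end JP

namespace JP

variable {n : ℕ}

structure Pre (φ : Mt n → Mt n) : Prop where
  sp : ∀ P : Mt n, P * P = P → ∃ A, φ A = P
  sn : ∀ P : Mt n, P * P = P → ∃ A, φ A = -P
  pres : ∀ A B, Rel A B ↔ Rel (φ A) (φ B)

lemma rel_self_neg_one {A : Mt n} (h1 : Rel A 1) (h2 : Rel A (-1)) : A = 0 := by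
  have := rel_pm h1 h2
  simp only [mul_one, one_mul, ← two_smul ℂ A] at this
  exact (smul_eq_zero.1 this).resolve_left (by norm_num)

lemma rel_zero_left (A : Mt n) : Rel 0 A := rel_of_zero (by simp)

lemma rel_self {A : Mt n} : Rel A A ↔ (A * A) * (A * A) = A * A := by
  unfold Rel
  rw [← two_smul ℂ (A * A), smul_mul_smul_comm, smul_smul]
  norm_num

section stage0
variable {A : Mt n} (hP : (A * A) * (A * A) = A * A)
  (hB : ∀ B, Rel A B → (B * B) * (B * B) = B * B)

lemma st0_sq_zero {A : Mt n} (hB : ∀ B, Rel A B → (B * B) * (B * B) = B * B) {B : Mt n}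
    (h : A * B + B * A = 0) : B * B = 0 := by
  have h1 := hB _ (rel_of_zero h)
  have h2 := hB _ (rel_smul_of_zero 2 h)
  simp only [smul_mul_smul_comm, h1] at h2
  have h3 : ((2 * 2 * (2 * 2) : ℂ) - 2 * 2) • (B * B) = 0 := by rw [sub_smul, h2, sub_self]
  exact (smul_eq_zero.1 h3).resolve_left (by norm_num)

lemma st0_L {A : Mt n} (hB : ∀ B, Rel A B → (B * B) * (B * B) = B * B) {v f : Vc n} {e : ℂ}
    (h1 : A *ᵥ (A *ᵥ v) = e • v) (h2 : (f ᵥ* A) ᵥ* A = e • f)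
    (h3 : f ⬝ᵥ v = 0) (h4 : f ⬝ᵥ (A *ᵥ v) = 1) : False := by
  have hz : A * (ro (A *ᵥ v) f - ro v (f ᵥ* A)) + (ro (A *ᵥ v) f - ro v (f ᵥ* A)) * A = 0 := by
    rw [mul_sub, sub_mul, mul_ro, mul_ro, ro_mul, ro_mul, h1, h2, ro_smul_left, ro_smul_right]
    abel
  have h0 := st0_sq_zero hB hz
  have e1 : (ro (A *ᵥ v) f - ro v (f ᵥ* A)) *ᵥ v = -v := by
    rw [sub_mulVec, ro_mulVec, ro_mulVec, vm_dot, h3, h4]; simp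
  have e2 := congrArg (fun M => M *ᵥ v) h0
  simp only [← mulVec_mulVec, e1, mulVec_neg, neg_neg, zero_mulVec] at e2
  rw [e2] at h4
  simp at h4

lemma st0_L' {A : Mt n} (hP : (A * A) * (A * A) = A * A)
    (hB : ∀ B, Rel A B → (B * B) * (B * B) = B * B) {v : Vc n} {e : ℂ} (he : e = 0 ∨ e = 1)
    (h1 : A *ᵥ (A *ᵥ v) = e • v) : ∃ c : ℂ, A *ᵥ v = c • v := by
  by_cases hv : v = 0
  · exact ⟨0, by simp [hv]⟩
  by_contra hcon
  push Not at hcon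
  obtain ⟨g, hg1, hg2⟩ := exists_dual2 hv hcon 0 1
  rcases he with rfl | rfl
  · apply st0_L hB (v := v) (f := g ᵥ* (1 - A * A)) h1
    · simp only [vecMul_vecMul]
      rw [show (1 - A * A) * A * A = A * A - (A * A) * (A * A) by noncomm_ring, hP]; simp
    · rw [vm_dot, sub_mulVec, ← mulVec_mulVec, h1]; simp [hg1]
    · rw [vm_dot, sub_mulVec, ← mulVec_mulVec, h1]; simp [hg2]
  · apply st0_L hB (v := v) (f := g ᵥ* (A * A)) h1
    · simp only [vecMul_vecMul]
      rw [show (A * A) * A * A = (A * A) * (A * A) by noncomm_ring, hP]; simp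
    · rw [vm_dot, ← mulVec_mulVec, h1]; simp [hg1]
    · rw [vm_dot, ← mulVec_mulVec, h1]; simp [hg2]

lemma st0_main {A : Mt n} (hP : (A * A) * (A * A) = A * A)
    (hB : ∀ B, Rel A B → (B * B) * (B * B) = B * B) : A = 1 ∨ A = -1 := by
  have h1 : A * (1 - A * A) = 0 := by
    apply mat_ext
    intro w
    have e0 : A *ᵥ (A *ᵥ ((1 - A * A) *ᵥ w)) = (0 : ℂ) • ((1 - A * A) *ᵥ w) := by
      simp only [mulVec_mulVec]
      rw [show A * (A * (1 - A * A)) = A * A - (A * A) * (A * A) by noncomm_ring, hP]; simp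
    obtain ⟨c, hc⟩ := st0_L' hP hB (Or.inl rfl) e0
    rw [← mulVec_mulVec, hc, zero_mulVec]
    rw [hc, mulVec_smul, hc, zero_smul, smul_smul, smul_eq_zero] at e0
    rcases e0 with e0 | e0
    · rw [mul_self_eq_zero.1 e0, zero_smul]
    · rw [e0, smul_zero]
  have h2 : (1 - A * A) * A = 0 := by
    rw [← h1]; noncomm_ring
  have h3 := st0_sq_zero hB (B := 1 - A * A) (by rw [h1, h2, add_zero])
  have h4 : A * A = 1 := by
    have : (1 - A * A) * (1 - A * A) = 1 - A * A - (A * A - (A * A) * (A * A)) := by noncomm_ring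
    rw [this, hP, sub_self, sub_zero, sub_eq_zero] at h3
    exact h3.symm
  by_contra hcon
  push Not at hcon
  obtain ⟨hc1, hc2⟩ := hcon
  have hA : ∀ v, A *ᵥ (A *ᵥ v) = v := fun v => by rw [mulVec_mulVec, h4, one_mulVec]
  obtain ⟨v, hv⟩ : ∃ v, v + A *ᵥ v ≠ 0 := by
    by_contra h; push Not at h
    exact hc2 (mat_ext fun v => by rw [neg_mulVec, one_mulVec]; exact eq_neg_of_add_eq_zero_right (h v))
  obtain ⟨w, hw⟩ : ∃ v, v - A *ᵥ v ≠ 0 := by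
    by_contra h; push Not at h
    exact hc1 (mat_ext fun v => by rw [one_mulVec]; exact (sub_eq_zero.1 (h v)).symm)
  set y := v + A *ᵥ v with hy
  set z := w - A *ᵥ w with hz
  have ey : A *ᵥ y = y := by rw [hy, mulVec_add, hA, add_comm]
  have ez : A *ᵥ z = -z := by rw [hz, mulVec_sub, hA, neg_sub]
  obtain ⟨c, hc⟩ := st0_L' hP hB (Or.inr rfl) (v := y + z) (by rw [hA, one_smul])
  rw [mulVec_add, ey, ez] at hc
  have hc' := congrArg (fun u => A *ᵥ u) hc
  simp only [mulVec_add, mulVec_neg, mulVec_smul, ey, ez] at hc'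
  have a1 : (1 - c) • y = 0 := by
    have : (2 : ℂ) • ((1 - c) • y) = 0 := by
      linear_combination (norm := module) hc + hc'
    exact (smul_eq_zero.1 this).resolve_left (by norm_num)
  have a2 : (1 + c) • z = 0 := by
    have : (2 : ℂ) • ((1 + c) • z) = 0 := by
      linear_combination (norm := module) hc' - hc
    exact (smul_eq_zero.1 this).resolve_left (by norm_num)
  have b1 := (smul_eq_zero.1 a1).resolve_right hv
  have b2 := (smul_eq_zero.1 a2).resolve_right hw
  have : (2 : ℂ) = 0 := by linear_combination b1 + b2
  norm_num at this
end stage0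

lemma Pre.eq_zero {φ : Mt n → Mt n} (h : Pre φ) {A : Mt n} (hA : φ A = 0) : A = 0 := by
  apply rel_self_neg_one <;> rw [h.pres, hA] <;> exact rel_zero_left _

lemma Pre.pm_one {φ : Mt n → Mt n} (h : Pre φ) {A : Mt n} (hA : φ A = 1 ∨ φ A = -1) :
    A = 1 ∨ A = -1 := by
  apply st0_main
  · rw [← rel_self, h.pres, rel_self]
    rcases hA with hA | hA <;> rw [hA] <;> simp
  · intro B hB
    rw [← rel_self, h.pres, rel_self]
    rw [h.pres, Rel.comm] at hB
    rcases hA with hA | hA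
    · rw [hA, rel_one] at hB
      rw [hB, hB]
    · rw [hA, rel_neg_right, rel_one] at hB
      simp only [neg_mul_neg] at hB
      rw [hB]; simpa using hB

structure Good (φ : Mt n → Mt n) : Prop extends Pre φ where
  one : φ 1 = 1
  neg_one : φ (-1) = -1

lemma Pre.good {φ : Mt n → Mt n} (h : Pre φ) : Good φ ∨ Good (fun A => -φ A) := by
  obtain ⟨A, hA⟩ := h.sp 1 (by simp)
  obtain ⟨B, hB⟩ := h.sn 1 (by simp)
  by_cases h11 : (1 : Mt n) = -1
  · have e : ∀ X : Mt n, X = 0 := by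
      intro X
      have h2 : (2 : ℂ) • (1 : Mt n) = 0 := by
        rw [two_smul]; nth_rewrite 2 [h11]; simp
      have h1 := (smul_eq_zero.1 h2).resolve_left (by norm_num)
      rw [← mul_one X, h1, mul_zero]
    left
    refine ⟨h, ?_, ?_⟩
    · rw [e (φ 1), e 1]
    · rw [e (φ (-1)), e (-1)]
  rcases h.pm_one (Or.inl hA) with rfl | rfl <;> rcases h.pm_one (Or.inr hB) with rfl | rfl
  · rw [hA] at hB; exact absurd hB h11
  · exact Or.inl ⟨h, hA, hB⟩
  · refine Or.inr ⟨⟨?_, ?_, ?_⟩, ?_, ?_⟩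
    · intro P hP
      obtain ⟨X, hX⟩ := h.sn P hP
      exact ⟨X, by simp [hX]⟩
    · intro P hP
      obtain ⟨X, hX⟩ := h.sp P hP
      exact ⟨X, by simp [hX]⟩
    · intro X Y
      rw [rel_neg_neg]; exact h.pres X Y
    · simp [hB]
    · simp [hA]
  · rw [hA] at hB; exact absurd hB h11

lemma pre_of_hyp (φ : Mt n → Mt n)
    (hrange : ∀ P : Mt n, ((P * P = P ∧ P ≠ 0) ∨ (P * P = -P ∧ P ≠ 0)) → ∃ A, φ A = P)
    (hpres : ∀ A B : Mt n, Rel A B ↔ Rel (φ A) (φ B)) : Pre φ := by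
  have h1 : ∃ A, φ A = 1 ∨ (1 : Mt n) = 0 := by
    by_cases h : (1 : Mt n) = 0
    · exact ⟨0, Or.inr h⟩
    · obtain ⟨A, hA⟩ := hrange 1 (Or.inl ⟨by simp, h⟩)
      exact ⟨A, Or.inl hA⟩
  have h0 : φ 0 = 0 := by
    by_cases h : (1 : Mt n) = 0
    · rw [← mul_one (φ 0), h, mul_zero]
    · obtain ⟨A, hA⟩ := hrange 1 (Or.inl ⟨by simp, h⟩)
      obtain ⟨B, hB⟩ := hrange (-1) (Or.inr ⟨by simp, by simpa using h⟩)
      apply rel_self_neg_one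
      · rw [← hA, ← hpres]; exact rel_zero_left _
      · rw [← hB, ← hpres]; exact rel_zero_left _
  refine ⟨fun P hP => ?_, fun P hP => ?_, hpres⟩
  · by_cases h : P = 0
    · exact ⟨0, by rw [h, h0]⟩
    · exact hrange P (Or.inl ⟨hP, h⟩)
  · by_cases h : P = 0
    · exact ⟨0, by rw [h, h0]; simp⟩
    · exact hrange (-P) (Or.inr ⟨by simpa using hP, by simpa using h⟩)

end JP

namespace JP

variable {n : ℕ}

lemma orth_iff {P Q : Mt n} (hP : P * P = P) (hQ : Q * Q = Q) :
    Rel P (-Q) ↔ P * Q = 0 ∧ Q * P = 0 := by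
  constructor
  · intro h
    have hP' : ∀ X : Mt n, X * P * P = X * P := fun X => by rw [mul_assoc, hP]
    have hQ' : ∀ X : Mt n, X * Q * Q = X * Q := fun X => by rw [mul_assoc, hQ]
    have h0 : P * Q * P * Q + P * Q * P + Q * P * Q + Q * P * Q * P
        + (2 : ℂ) • (P * Q) + (2 : ℂ) • (Q * P) = 0 := by
      unfold Rel at h
      simp only [mul_neg, neg_mul, ← neg_add, neg_neg, smul_neg] at h
      simp only [mul_add, add_mul, ← mul_assoc, hP, hQ, hP', hQ'] at h
      rw [eq_neg_iff_add_eq_zero] at h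
      rw [← h, smul_add]; abel
    have z1 : (3 : ℂ) • (P * Q * P * Q * P) = -(5 : ℂ) • (P * Q * P) := by
      have := congrArg (fun X => P * X * P) h0
      simp only [mul_add, add_mul, ← mul_assoc, hP, hP', mul_smul_comm, smul_mul_assoc,
        mul_zero, zero_mul] at this
      linear_combination (norm := module) this
    have y1 : (P * Q * P * Q - P * Q * P * Q * P) = -(P * Q - P * Q * P) := by
      have := congrArg (fun X => P * X * (1 - P)) h0
      simp only [mul_add, add_mul, mul_sub, mul_one, ← mul_assoc, hP, hP', mul_smul_comm, smul_mul_assoc,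
        mul_zero, zero_mul] at this
      linear_combination (norm := module) (2⁻¹ : ℂ) • this
    have y2 : (Q * P * Q * P - P * Q * P * Q * P) = -(Q * P - P * Q * P) := by
      have := congrArg (fun X => (1 - P) * X * P) h0
      simp only [mul_add, add_mul, sub_mul, one_mul, ← mul_assoc, hP, hP', mul_smul_comm, smul_mul_assoc,
        mul_zero, zero_mul] at this
      linear_combination (norm := module) (2⁻¹ : ℂ) • this
    have e1 : P * Q = P * Q * P := by
      have a := congrArg (fun X => X * Q * (1 - P)) z1
      have b := congrArg (fun X => P * Q * P * X) y1
      simp only [mul_add, add_mul, mul_sub, mul_one, mul_neg, ← mul_assoc, hP, hP', mul_smul_comm, smul_mul_assoc,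
        mul_zero, zero_mul] at a b
      linear_combination (norm := module) y1 - (2⁻¹ : ℂ) • a + (3 / 2 : ℂ) • b
    have e2 : Q * P = P * Q * P := by
      have a := congrArg (fun X => (1 - P) * Q * X) z1
      have b := congrArg (fun X => X * P * Q * P) y2
      simp only [mul_add, add_mul, sub_mul, one_mul, neg_mul, ← mul_assoc, hP, hP', mul_smul_comm, smul_mul_assoc,
        mul_zero, zero_mul] at a b
      linear_combination (norm := module) y2 - (2⁻¹ : ℂ) • a + (3 / 2 : ℂ) • b
    have e3 : P * Q * P * Q * P = P * Q * P := by
      rw [← e1, hQ', ← e1]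
    rw [e3] at z1
    have e4 : P * Q * P = 0 := by
      linear_combination (norm := module) (8⁻¹ : ℂ) • z1
    exact ⟨e1.trans e4, e2.trans e4⟩
  · rintro ⟨h1, h2⟩
    apply rel_of_zero; simp [h1, h2]

/-- order on idempotents -/
def Le (P R : Mt n) : Prop := P * R = P ∧ R * P = P

lemma Le.antisymm {P R : Mt n} (h : Le P R) (h' : Le R P) : P = R := by
  rw [← h.1, h'.2]

lemma Le.trans {P Q R : Mt n} (h : Le P Q) (h' : Le Q R) : Le P R :=
  ⟨by rw [← h.1, mul_assoc, h'.1], by rw [← h.2, ← mul_assoc, h'.2]⟩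

lemma Le.refl {P : Mt n} (h : P * P = P) : Le P P := ⟨h, h⟩

lemma compl_idem {R : Mt n} (hR : R * R = R) : (1 - R) * (1 - R) = 1 - R := by
  rw [show (1 - R) * (1 - R) = 1 - R - (R - R * R) by noncomm_ring, hR]; simp

lemma le_iff_rel {P R : Mt n} (hP : P * P = P) (hR : R * R = R) : Le P R ↔ Rel P (-(1 - R)) := by
  rw [orth_iff hP (compl_idem hR), mul_sub, sub_mul, mul_one, one_mul, sub_eq_zero, sub_eq_zero]
  exact ⟨fun h => ⟨h.1.symm, h.2.symm⟩, fun h => ⟨h.1.symm, h.2.symm⟩⟩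

variable {φ : Mt n → Mt n}

lemma Good.zero (h : Good φ) : φ 0 = 0 := by
  apply rel_self_neg_one
  · rw [← h.one, ← h.pres]; exact rel_zero_left _
  · rw [← h.neg_one, ← h.pres]; exact rel_zero_left _

lemma Good.idem (h : Good φ) (P : Mt n) : φ P * φ P = φ P ↔ P * P = P := by
  rw [← rel_one, ← rel_one, h.pres P 1, h.one]

lemma Good.nidem (h : Good φ) (P : Mt n) : (-φ P) * (-φ P) = -φ P ↔ (-P) * (-P) = -P := by
  rw [← rel_one, ← rel_one, ← rel_neg_right, ← rel_neg_right, h.pres P (-1), h.neg_one]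

def theta (φ : Mt n → Mt n) (R : Mt n) : Mt n := 1 + φ (-(1 - R))

lemma Good.theta_idem (h : Good φ) {R : Mt n} (hR : R * R = R) :
    theta φ R * theta φ R = theta φ R := by
  have := (h.nidem (-(1 - R))).2 (by rw [neg_neg]; exact compl_idem hR)
  have := compl_idem this
  rw [sub_neg_eq_add] at this; exact this

lemma Good.theta_le (h : Good φ) {P R : Mt n} (hP : P * P = P) (hR : R * R = R) :
    Le P R ↔ Le (φ P) (theta φ R) := by
  rw [le_iff_rel hP hR, le_iff_rel ((h.idem P).2 hP) (h.theta_idem hR), h.pres]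
  unfold theta
  simp

lemma Good.surj_idem (h : Good φ) {Q : Mt n} (hQ : Q * Q = Q) : ∃ X, X * X = X ∧ φ X = Q := by
  obtain ⟨X, hX⟩ := h.sp Q hQ
  exact ⟨X, (h.idem X).1 (by rw [hX, hQ]), hX⟩

lemma Good.theta_eq (h : Good φ) {P : Mt n} (hP : P * P = P) : theta φ P = φ P := by
  obtain ⟨X, hX, e⟩ := h.surj_idem (h.theta_idem hP)
  have h1 : Le X P := by
    rw [h.theta_le hX hP, e]; exact Le.refl (h.theta_idem hP)
  have h2 : Le P X := by
    rw [h.theta_le hP hX]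
    apply Le.trans ((h.theta_le hP hP).1 (Le.refl hP))
    rw [← e]; exact (h.theta_le hX hX).1 (Le.refl hX)
  rw [← e, h1.antisymm h2]

lemma Good.le_iff (h : Good φ) {P R : Mt n} (hP : P * P = P) (hR : R * R = R) :
    Le P R ↔ Le (φ P) (φ R) := by
  rw [h.theta_le hP hR, h.theta_eq hR]

lemma Good.inj (h : Good φ) {P R : Mt n} (hP : P * P = P) (hR : R * R = R) (e : φ P = φ R) :
    P = R := by
  apply Le.antisymm
  · rw [h.le_iff hP hR, e]; exact Le.refl ((h.idem R).2 hR)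
  · rw [h.le_iff hR hP, e]; exact Le.refl ((h.idem R).2 hR)

lemma Good.neg_compl (h : Good φ) {R : Mt n} (hR : R * R = R) : φ (-(1 - R)) = -(1 - φ R) := by
  have := h.theta_eq hR
  unfold theta at this
  rw [← this]; abel

/-- rank one idempotents -/
def R1 (P : Mt n) : Prop := ∃ x f : Vc n, f ⬝ᵥ x = 1 ∧ P = ro x f

lemma R1.idem {P : Mt n} (h : R1 P) : P * P = P := by
  obtain ⟨x, f, h1, rfl⟩ := h; exact ro_idem h1

lemma R1.ne_zero {P : Mt n} (h : R1 P) : P ≠ 0 := by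
  obtain ⟨x, f, h1, rfl⟩ := h
  obtain ⟨a, b⟩ := ne_zero_of_dot one_ne_zero h1
  rw [Ne, ro_eq_zero]; tauto

lemma exists_R1_le {P : Mt n} (hP : P * P = P) {x0 : Vc n} (h0 : P *ᵥ x0 ≠ 0) :
    ∃ f : Vc n, f ⬝ᵥ (P *ᵥ x0) = 1 ∧ Le (ro (P *ᵥ x0) f) P := by
  obtain ⟨g, hg⟩ := exists_dual1 h0
  refine ⟨g ᵥ* P, ?_, ?_, ?_⟩
  · rw [vm_dot, mulVec_mulVec, hP, hg]
  · rw [ro_mul, vecMul_vecMul, hP]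
  · rw [mul_ro, mulVec_mulVec, hP]

lemma R1_iff {P : Mt n} (hP : P * P = P) :
    R1 P ↔ P ≠ 0 ∧ ∀ Q : Mt n, Q * Q = Q → Le Q P → Q = 0 ∨ Q = P := by
  constructor
  · intro h
    refine ⟨h.ne_zero, ?_⟩
    obtain ⟨x, f, h1, rfl⟩ := h
    intro Q hQ hle
    have e : Q = (f ⬝ᵥ (Q *ᵥ x)) • ro x f := by
      conv_lhs => rw [← hle.2, ← hle.1, mul_ro, ro_mul_ro]
    by_cases hQ0 : Q = 0
    · exact Or.inl hQ0
    right
    set c := f ⬝ᵥ (Q *ᵥ x)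
    have hc : c * c = c := by
      have h2 := hQ
      rw [e, smul_mul_smul_comm, hP, ← sub_eq_zero, ← sub_smul, smul_eq_zero] at h2
      rcases h2 with h2 | h2
      · exact sub_eq_zero.1 h2
      · rw [h2, smul_zero] at e; exact absurd e hQ0
    have hc0 : c ≠ 0 := by
      intro h; rw [h, zero_smul] at e; exact hQ0 e
    have : c = 1 := mul_left_cancel₀ hc0 (by rw [hc, mul_one])
    rw [e, this, one_smul]
  · rintro ⟨h0, hmin⟩
    obtain ⟨x0, hx0⟩ : ∃ x0, P *ᵥ x0 ≠ 0 := by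
      by_contra hcon; push Not at hcon
      exact h0 (mat_ext fun v => by rw [hcon, zero_mulVec])
    obtain ⟨f, hf, hle⟩ := exists_R1_le hP hx0
    have hR : R1 (ro (P *ᵥ x0) f) := ⟨_, _, hf, rfl⟩
    rcases hmin _ hR.idem hle with h | h
    · exact absurd h hR.ne_zero
    · exact ⟨_, _, hf, h.symm⟩

lemma Good.R1_iff (h : Good φ) {P : Mt n} (hP : P * P = P) : R1 (φ P) ↔ R1 P := by
  rw [JP.R1_iff hP, JP.R1_iff ((h.idem P).2 hP)]
  have h0 : (φ P ≠ 0) ↔ P ≠ 0 := by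
    rw [not_iff_not]
    constructor
    · intro e; exact h.toPre.eq_zero e
    · intro e; rw [e, h.zero]
  rw [h0]
  refine and_congr_right fun _ => ⟨fun H Q hQ hle => ?_, fun H Q hQ hle => ?_⟩
  · rcases H (φ Q) ((h.idem Q).2 hQ) ((h.le_iff hQ hP).1 hle) with e | e
    · exact Or.inl (h.toPre.eq_zero e)
    · exact Or.inr (h.inj hQ hP e)
  · obtain ⟨X, hX, rfl⟩ := h.surj_idem hQ
    rcases H X hX ((h.le_iff hX hP).2 hle) with e | e
    · left; rw [e, h.zero]
    · right; rw [e]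

lemma Good.surj_R1 (h : Good φ) {Q : Mt n} (hQ : R1 Q) : ∃ X, R1 X ∧ φ X = Q := by
  obtain ⟨X, hX, e⟩ := h.surj_idem hQ.idem
  exact ⟨X, (h.R1_iff hX).1 (e ▸ hQ), e⟩

lemma Good.map_R1 (h : Good φ) {P : Mt n} (hP : R1 P) : R1 (φ P) := (h.R1_iff hP.idem).2 hP

lemma Good.transpose (h : Good φ) : Good (fun A => (φ A)ᵀ) := by
  refine ⟨⟨?_, ?_, ?_⟩, ?_, ?_⟩
  · intro P hP
    obtain ⟨X, hX⟩ := h.sp Pᵀ (by rw [← transpose_mul, hP])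
    exact ⟨X, by simp [hX]⟩
  · intro P hP
    obtain ⟨X, hX⟩ := h.sn Pᵀ (by rw [← transpose_mul, hP])
    exact ⟨X, by simp [hX]⟩
  · intro X Y
    rw [rel_transpose]; exact h.pres X Y
  · simp [h.one]
  · simp [h.neg_one]

end JP

namespace JP

variable {n : ℕ}

def SI (P Q : Mt n) : Prop := P * Q = Q ∧ Q * P = P
def SK (P Q : Mt n) : Prop := P * Q = P ∧ Q * P = Q
def Adj (P Q : Mt n) : Prop := SI P Q ∨ SK P Q
def Orth (P Q : Mt n) : Prop := P * Q = 0 ∧ Q * P = 0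

lemma SI.symm {P Q : Mt n} (h : SI P Q) : SI Q P := ⟨h.2, h.1⟩
lemma SK.symm {P Q : Mt n} (h : SK P Q) : SK Q P := ⟨h.2, h.1⟩
lemma Adj.symm {P Q : Mt n} (h : Adj P Q) : Adj Q P := h.imp SI.symm SK.symm
lemma SI.trans {P Q R : Mt n} (h : SI P Q) (h' : SI Q R) : SI P R :=
  ⟨by rw [← h'.1, ← mul_assoc, h.1], by rw [← h.2, ← mul_assoc, h'.2]⟩
lemma SK.trans {P Q R : Mt n} (h : SK P Q) (h' : SK Q R) : SK P R :=
  ⟨by rw [← h.1, mul_assoc, h'.1], by rw [← h'.2, mul_assoc, h.2]⟩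

lemma SI_transpose {P Q : Mt n} : SI Pᵀ Qᵀ ↔ SK P Q := by
  unfold SI SK
  rw [← transpose_mul, ← transpose_mul, transpose_inj, transpose_inj, and_comm]

lemma SK_transpose {P Q : Mt n} : SK Pᵀ Qᵀ ↔ SI P Q := by
  unfold SI SK
  rw [← transpose_mul, ← transpose_mul, transpose_inj, transpose_inj, and_comm]

lemma relR1 {P Q : Mt n} (hP : R1 P) (hQ : R1 Q) : Rel P Q ↔ Orth P Q ∨ Adj P Q := by
  constructor
  · intro h
    have hPi := hP.idem
    have hQi := hQ.idem
    have hP0 := hP.ne_zero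
    have hP' : ∀ X : Mt n, X * P * P = X * P := fun X => by rw [mul_assoc, hPi]
    have hQ' : ∀ X : Mt n, X * Q * Q = X * Q := fun X => by rw [mul_assoc, hQi]
    obtain ⟨x, f, hf, eP⟩ := hP
    obtain ⟨y, g, hg, eQ⟩ := hQ
    obtain ⟨p, hp⟩ : ∃ p, p = f ⬝ᵥ y := ⟨_, rfl⟩
    obtain ⟨q, hq⟩ : ∃ q, q = g ⬝ᵥ x := ⟨_, rfl⟩
    obtain ⟨c, hc⟩ : ∃ c, c = p * q := ⟨_, rfl⟩
    have e1 : P * Q * P = c • P := by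
      rw [eP, eQ, ro_mul_ro, smul_mul_assoc, ro_mul_ro, smul_smul, ← hp, ← hq, hc]
    have e2 : Q * P * Q = c • Q := by
      rw [eP, eQ, ro_mul_ro, smul_mul_assoc, ro_mul_ro, smul_smul, ← hp, ← hq, hc, mul_comm]
    have h0 : c • (P * Q) + c • P + c • Q + c • (Q * P) = (2 : ℂ) • (P * Q) + (2 : ℂ) • (Q * P) := by
      unfold Rel at h
      simp only [mul_add, add_mul, ← mul_assoc, hPi, hQi, hP', hQ', e1, e2, smul_mul_assoc, smul_add] at h
      rw [← h]; abel
    by_cases hc1 : c = 1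
    · right
      have h3 : P + Q = P * Q + Q * P := by
        rw [hc1] at h0
        linear_combination (norm := module) h0
      have h4 : ro (x - q • y) (f - p • g) = 0 := by
        simp only [ro_sub_left, ro_sub_right, ro_smul_left, ro_smul_right, smul_smul, ← hc, smul_sub]
        rw [eP, eQ, ro_mul_ro, ro_mul_ro, ← hp, ← hq] at h3
        rw [hc1]
        linear_combination (norm := module) h3
      rcases ro_eq_zero.1 h4 with h5 | h5
      · left
        rw [sub_eq_zero] at h5
        constructor
        · rw [eP, eQ, ro_mul_ro, ← hp]
          rw [h5, ro_smul_left, smul_smul, ← hc, hc1, one_smul]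
        · rw [eP, eQ, ro_mul_ro, ← hq]
          rw [h5, ro_smul_left]
      · right
        rw [sub_eq_zero] at h5
        constructor
        · rw [eP, eQ, ro_mul_ro, ← hp]
          rw [h5, ro_smul_right]
        · rw [eP, eQ, ro_mul_ro, ← hq]
          rw [h5, ro_smul_right, smul_smul, mul_comm, ← hc, hc1, one_smul]
    · left
      have hc2 : c - 1 ≠ 0 := sub_ne_zero.2 hc1
      have a1 : (c - 1) • ((2 : ℂ) • (P * Q) + c • P) = 0 := by
        have := congrArg (fun X => P * X) h0
        simp only [mul_add, ← mul_assoc, hPi, hP', mul_smul_comm, e1] at this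
        linear_combination (norm := module) this
      have a2 : (c - 1) • ((2 : ℂ) • (Q * P) + c • P) = 0 := by
        have := congrArg (fun X => X * P) h0
        simp only [add_mul, ← mul_assoc, hPi, hP', smul_mul_assoc, e1] at this
        linear_combination (norm := module) this
      have b1 := (smul_eq_zero.1 a1).resolve_left hc2
      have b2 := (smul_eq_zero.1 a2).resolve_left hc2
      have hc0 : c = 0 := by
        have := congrArg (fun X => X * P) b1
        simp only [add_mul, ← mul_assoc, hPi, hP', smul_mul_assoc, e1, zero_mul, smul_smul, ← add_smul] at this
        have := (smul_eq_zero.1 this).resolve_right hP0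
        linear_combination this / 3
      rw [hc0, zero_smul, add_zero] at b1 b2
      exact ⟨(smul_eq_zero.1 b1).resolve_left (by norm_num),
        (smul_eq_zero.1 b2).resolve_left (by norm_num)⟩
  · have hPi := hP.idem
    have hQi := hQ.idem
    rintro (⟨h1, h2⟩ | ⟨h1, h2⟩ | ⟨h1, h2⟩)
    · apply rel_of_zero; rw [h1, h2, add_zero]
    · unfold Rel
      rw [h1, h2]; simp only [mul_add, add_mul, h1, h2, hPi, hQi]; module
    · unfold Rel
      rw [h1, h2]; simp only [mul_add, add_mul, h1, h2, hPi, hQi]; module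

def HasLub (P Q : Mt n) : Prop := ∃ L, L * L = L ∧ Le P L ∧ Le Q L ∧
  ∀ E, E * E = E → Le P E → Le Q E → Le L E

lemma Le_transpose {P Q : Mt n} : Le Pᵀ Qᵀ ↔ Le P Q := by
  unfold Le
  rw [← transpose_mul, ← transpose_mul, transpose_inj, transpose_inj, and_comm]

lemma HasLub.transpose {P Q : Mt n} (h : HasLub P Q) : HasLub Pᵀ Qᵀ := by
  obtain ⟨L, h1, h2, h3, h4⟩ := h
  refine ⟨Lᵀ, by rw [← transpose_mul, h1], Le_transpose.2 h2, Le_transpose.2 h3, ?_⟩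
  intro E hE a b
  rw [← transpose_transpose E] at a b ⊢
  exact Le_transpose.2 (h4 _ (by rw [← transpose_mul, hE]) (Le_transpose.1 a) (Le_transpose.1 b))

lemma Orth.hasLub {P Q : Mt n} (hP : P * P = P) (hQ : Q * Q = Q) (h : Orth P Q) : HasLub P Q := by
  obtain ⟨h1, h2⟩ := h
  refine ⟨P + Q, ?_, ⟨?_, ?_⟩, ⟨?_, ?_⟩, ?_⟩
  · simp [mul_add, add_mul, h1, h2, hP, hQ]
  · simp [mul_add, add_mul, h1, h2, hP, hQ]
  · simp [mul_add, add_mul, h1, h2, hP, hQ]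
  · simp [mul_add, add_mul, h1, h2, hP, hQ]
  · simp [mul_add, add_mul, h1, h2, hP, hQ]
  · intro E hE a b
    exact ⟨by rw [add_mul, a.1, b.1], by rw [mul_add, a.2, b.2]⟩

lemma exists_ker2 (hn : 3 ≤ n) (f g : Vc n) : ∃ w : Vc n, w ≠ 0 ∧ f ⬝ᵥ w = 0 ∧ g ⬝ᵥ w = 0 := by
  let F : Vc n →ₗ[ℂ] (Fin 2 → ℂ) := Matrix.mulVecLin (Matrix.of ![f, g])
  have hk : LinearMap.ker F ≠ ⊥ := by
    apply LinearMap.ker_ne_bot_of_finrank_lt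
    simp; omega
  obtain ⟨w, hw, h0⟩ := Submodule.exists_mem_ne_zero_of_ne_bot hk
  refine ⟨w, h0, ?_, ?_⟩
  · have := congrFun (LinearMap.mem_ker.1 hw) 0
    simpa [F, mulVec] using this
  · have := congrFun (LinearMap.mem_ker.1 hw) 1
    simpa [F, mulVec] using this

lemma SI.form {x f : Vc n} {Q : Mt n} (hf : f ⬝ᵥ x = 1) (h : SI (ro x f) Q) :
    ∃ g, g ⬝ᵥ x = 1 ∧ Q = ro x g := by
  refine ⟨f ᵥ* Q, ?_, ?_⟩
  · have := congrArg (fun X => X *ᵥ x) h.2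
    simp only [← mulVec_mulVec, ro_mulVec, hf, one_smul] at this
    rw [vm_dot, this, hf]
  · rw [← ro_mul, h.1]

lemma SI.no_lub (hn : 3 ≤ n) {P Q : Mt n} (hP : R1 P) (hne : P ≠ Q) (h : SI P Q) :
    ¬ HasLub P Q := by
  obtain ⟨x, f, hf, rfl⟩ := hP
  obtain ⟨g, hg, rfl⟩ := h.form hf
  rintro ⟨L, hL, l1, l2, l3⟩
  obtain ⟨hx0, hf0⟩ := ne_zero_of_dot one_ne_zero hf
  have hfg : f ≠ g := by rintro rfl; exact hne rfl
  have hpar : ∀ c : ℂ, g ≠ c • f := by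
    intro c hc
    have : c = 1 := by rw [hc, smul_dotProduct, hf] at hg; simpa using hg
    rw [this, one_smul] at hc; exact hfg hc.symm
  obtain ⟨z, hz1, hz2⟩ := exists_dual2' hf0 hpar 0 1
  obtain ⟨w, hw0, hw1, hw2⟩ := exists_ker2 hn f g
  have fL : f ᵥ* L = f := by
    have := l1.1; rw [ro_mul] at this; exact ro_inj_right hx0 this
  have gL : g ᵥ* L = g := by
    have := l2.1; rw [ro_mul] at this; exact ro_inj_right hx0 this
  have key : ∀ z, f ⬝ᵥ z = 0 → g ⬝ᵥ z = 1 → L = ro x f + ro z (g - f) := by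
    intro z hz1 hz2
    have i1 : (ro x f + ro z (g - f)) * (ro x f + ro z (g - f)) = ro x f + ro z (g - f) := by
      simp only [mul_add, add_mul, ro_mul_ro, sub_dotProduct, hf, hg, hz1, hz2]; simp
    have i2 := l3 _ i1 ⟨by simp only [mul_add, ro_mul_ro, hf, hz1]; simp,
        by simp only [add_mul, ro_mul_ro, sub_dotProduct, hf, hg]; simp⟩
        ⟨by simp only [mul_add, ro_mul_ro, hg, hz2, one_smul]; rw [ro_sub_right]; abel,
        by simp only [add_mul, ro_mul_ro, sub_dotProduct, hf, hg]; simp⟩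
    have := i2.2
    rw [add_mul, ro_mul, ro_mul, sub_vecMul, fL, gL] at this
    exact this.symm
  have k1 := key z hz1 hz2
  have k2 := key (z + w) (by rw [dotProduct_add, hz1, hw1, add_zero]) (by rw [dotProduct_add, hz2, hw2, add_zero])
  rw [k1, ro_add_left] at k2
  have : ro w (g - f) = 0 := by
    linear_combination (norm := module) -k2
  rcases ro_eq_zero.1 this with h | h
  · exact hw0 h
  · exact hfg (sub_eq_zero.1 h).symm

lemma R1.transpose {P : Mt n} (hP : R1 P) : R1 Pᵀ := by
  obtain ⟨x, f, hf, rfl⟩ := hP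
  exact ⟨f, x, by rw [dotProduct_comm, hf], ro_transpose _ _⟩

lemma SK.no_lub (hn : 3 ≤ n) {P Q : Mt n} (hP : R1 P) (hne : P ≠ Q) (h : SK P Q) :
    ¬ HasLub P Q := fun hl =>
  SI.no_lub hn hP.transpose (by rwa [Ne, transpose_inj]) (SI_transpose.2 h) hl.transpose

lemma orth_char (hn : 3 ≤ n) {P Q : Mt n} (hP : R1 P) (hQ : R1 Q) :
    Orth P Q ↔ Rel P Q ∧ P ≠ Q ∧ HasLub P Q := by
  constructor
  · intro h
    refine ⟨(relR1 hP hQ).2 (Or.inl h), ?_, h.hasLub hP.idem hQ.idem⟩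
    rintro rfl
    have := h.1; rw [hP.idem] at this; exact hP.ne_zero this
  · rintro ⟨h1, h2, h3⟩
    rcases (relR1 hP hQ).1 h1 with h | h | h
    · exact h
    · exact absurd h3 (h.no_lub hn hP h2)
    · exact absurd h3 (h.no_lub hn hP h2)

lemma adj_char {P Q : Mt n} (hP : R1 P) (hQ : R1 Q) :
    Adj P Q ↔ Rel P Q ∧ ¬ Orth P Q := by
  rw [relR1 hP hQ]
  have : Adj P Q → ¬ Orth P Q := by
    rintro (h | h) h'
    · have := h.1; rw [h'.1] at this; exact hQ.ne_zero this.symm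
    · have := h.1; rw [h'.1] at this; exact hP.ne_zero this.symm
  exact ⟨fun h => ⟨Or.inr h, this h⟩, fun h => h.1.resolve_left h.2⟩

variable {φ : Mt n → Mt n}

lemma Good.hasLub (h : Good φ) {P Q : Mt n} (hP : P * P = P) (hQ : Q * Q = Q) :
    HasLub (φ P) (φ Q) ↔ HasLub P Q := by
  constructor
  · rintro ⟨L, h1, h2, h3, h4⟩
    obtain ⟨X, hX, rfl⟩ := h.surj_idem h1
    refine ⟨X, hX, (h.le_iff hP hX).2 h2, (h.le_iff hQ hX).2 h3, fun E hE a b => ?_⟩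
    exact (h.le_iff hX hE).2 (h4 _ ((h.idem E).2 hE) ((h.le_iff hP hE).1 a) ((h.le_iff hQ hE).1 b))
  · rintro ⟨L, h1, h2, h3, h4⟩
    refine ⟨φ L, (h.idem L).2 h1, (h.le_iff hP h1).1 h2, (h.le_iff hQ h1).1 h3, fun E hE a b => ?_⟩
    obtain ⟨X, hX, rfl⟩ := h.surj_idem hE
    exact (h.le_iff h1 hX).1 (h4 _ hX ((h.le_iff hP hX).2 a) ((h.le_iff hQ hX).2 b))

lemma Good.orth (hn : 3 ≤ n) (h : Good φ) {P Q : Mt n} (hP : R1 P) (hQ : R1 Q) :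
    Orth (φ P) (φ Q) ↔ Orth P Q := by
  rw [orth_char hn hP hQ, orth_char hn (h.map_R1 hP) (h.map_R1 hQ), ← h.pres,
    h.hasLub hP.idem hQ.idem]
  have : φ P ≠ φ Q ↔ P ≠ Q := by
    rw [not_iff_not]
    exact ⟨fun e => h.inj hP.idem hQ.idem e, fun e => by rw [e]⟩
  rw [this]

lemma Good.adj (hn : 3 ≤ n) (h : Good φ) {P Q : Mt n} (hP : R1 P) (hQ : R1 Q) :
    Adj (φ P) (φ Q) ↔ Adj P Q := by
  rw [adj_char hP hQ, adj_char (h.map_R1 hP) (h.map_R1 hQ), ← h.pres, h.orth hn hP hQ]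

lemma SI_ro {x f g : Vc n} (hf : f ⬝ᵥ x = 1) (hg : g ⬝ᵥ x = 1) : SI (ro x f) (ro x g) := by
  constructor <;> rw [ro_mul_ro] <;> simp [hf, hg]
lemma SK_ro {x y f : Vc n} (hf : f ⬝ᵥ x = 1) (hg : f ⬝ᵥ y = 1) : SK (ro x f) (ro y f) := by
  constructor <;> rw [ro_mul_ro] <;> simp [hf, hg]

lemma not_adj {x y f g : Vc n} (hf : f ⬝ᵥ x = 1) (hg : g ⬝ᵥ y = 1) (h1 : ∀ c : ℂ, y ≠ c • x)
    (h2 : ∀ c : ℂ, f ≠ c • g) : ¬ Adj (ro x f) (ro y g) := by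
  rintro (⟨h, -⟩ | ⟨h, -⟩)
  · rw [ro_mul_ro, ← ro_smul_left] at h
    exact h1 _ (ro_inj_left (ne_zero_of_dot one_ne_zero hg).2 h).symm
  · rw [ro_mul_ro, ← ro_smul_right] at h
    exact h2 _ (ro_inj_right (ne_zero_of_dot one_ne_zero hf).1 h).symm

def Ty1 (φ : Mt n → Mt n) (x : Vc n) : Prop :=
  ∀ f g : Vc n, f ⬝ᵥ x = 1 → g ⬝ᵥ x = 1 → SI (φ (ro x f)) (φ (ro x g))
def Ty2 (φ : Mt n → Mt n) (x : Vc n) : Prop :=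
  ∀ f g : Vc n, f ⬝ᵥ x = 1 → g ⬝ᵥ x = 1 → SK (φ (ro x f)) (φ (ro x g))

lemma Good.ty (hn : 3 ≤ n) (h : Good φ) (x : Vc n) : Ty1 φ x ∨ Ty2 φ x := by
  by_cases h2 : Ty2 φ x
  · exact Or.inr h2
  left
  unfold Ty2 at h2
  push Not at h2
  obtain ⟨f1, f2, hf1, hf2, hns⟩ := h2
  have adj : ∀ f g : Vc n, f ⬝ᵥ x = 1 → g ⬝ᵥ x = 1 → Adj (φ (ro x f)) (φ (ro x g)) := by
    intro f g hf hg
    rw [h.adj hn ⟨_, _, hf, rfl⟩ ⟨_, _, hg, rfl⟩]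
    exact Or.inl (SI_ro hf hg)
  have s12 : SI (φ (ro x f1)) (φ (ro x f2)) := (adj _ _ hf1 hf2).resolve_right hns
  have key : ∀ f : Vc n, f ⬝ᵥ x = 1 → SI (φ (ro x f)) (φ (ro x f1)) := by
    intro f hf
    rcases adj f f1 hf hf1 with a | a
    · exact a
    rcases adj f f2 hf hf2 with b | b
    · exact b.trans s12.symm
    · exact absurd (a.symm.trans b) hns
  intro f g hf hg
  exact (key f hf).trans (key g hg).symm

/-- A convenient configuration -/
lemma conf_exists {x y : Vc n} (hx : x ≠ 0) (hy : ∀ c : ℂ, y ≠ c • x) {f1 : Vc n}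
    (h1 : f1 ⬝ᵥ x = 1) (h2 : f1 ⬝ᵥ y = 1) :
    ∃ f2 g2 : Vc n, f2 ⬝ᵥ x = 1 ∧ g2 ⬝ᵥ y = 1 ∧ Adj (ro x f2) (ro y g2) ∧
      ¬ Adj (ro x f1) (ro y g2) ∧ ¬ Adj (ro x f2) (ro y f1) := by
  obtain ⟨f2, a1, a2⟩ := exists_dual2 hx hy 1 2
  have np1 : ∀ c : ℂ, f1 ≠ c • f2 := by
    intro c hc
    have b1 := h1; have b2 := h2
    rw [hc, smul_dotProduct, a1] at b1
    rw [hc, smul_dotProduct, a2] at b2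
    simp only [smul_eq_mul] at b1 b2
    have : (1 : ℂ) = 0 := by linear_combination b2 - 2 * b1
    norm_num at this
  have np2 : ∀ c : ℂ, f2 ≠ c • f1 := by
    intro c hc
    have b1 := a1; have b2 := a2
    rw [hc, smul_dotProduct, h1] at b1
    rw [hc, smul_dotProduct, h2] at b2
    simp only [smul_eq_mul] at b1 b2
    have : (1 : ℂ) = 0 := by linear_combination b1 - b2
    norm_num at this
  have g2y : ((2⁻¹ : ℂ) • f2) ⬝ᵥ y = 1 := by rw [smul_dotProduct, a2]; norm_num
  refine ⟨f2, (2⁻¹ : ℂ) • f2, a1, g2y, ?_, ?_, ?_⟩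
  · right
    constructor <;> simp only [ro_smul_right, mul_smul_comm, smul_mul_assoc, ro_mul_ro, a1, a2, smul_smul] <;> norm_num
  · exact not_adj h1 g2y hy (fun c => by rw [smul_smul]; exact np1 _)
  · exact not_adj a1 h2 hy np2

lemma Good.ty_all (hn : 3 ≤ n) (h : Good φ) : (∀ x, Ty1 φ x) ∨ (∀ x, Ty2 φ x) := by
  by_contra hcon
  push Not at hcon
  obtain ⟨⟨x, hx1⟩, ⟨y, hy2⟩⟩ := hcon
  have hx2 := (h.ty hn x).resolve_left hx1
  have hy1 := (h.ty hn y).resolve_right hy2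
  have hx : x ≠ 0 := by
    rintro rfl
    exact hx1 fun f g hf hg => by simp at hf
  have hpar : ∀ c : ℂ, y ≠ c • x := by
    rintro c rfl
    by_cases hc : c = 0
    · subst hc
      exact hy2 fun f g hf hg => by simp at hf
    apply hy2
    intro f g hf hg
    have e : ∀ f : Vc n, ro (c • x) f = ro x (c • f) := fun f => by rw [ro_smul_left, ro_smul_right]
    rw [e, e]
    rw [dotProduct_smul, ← smul_dotProduct] at hf hg
    exact hx2 _ _ hf hg
  obtain ⟨f1, h1, h2⟩ := exists_dual2 hx hpar 1 1
  obtain ⟨f2, g2, k1, k2, k3, k4, k5⟩ := conf_exists hx hpar h1 h2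
  have rp1 : R1 (ro x f1) := ⟨_, _, h1, rfl⟩
  have rp2 : R1 (ro x f2) := ⟨_, _, k1, rfl⟩
  have rq1 : R1 (ro y f1) := ⟨_, _, h2, rfl⟩
  have rq2 : R1 (ro y g2) := ⟨_, _, k2, rfl⟩
  have A1 : Adj (φ (ro x f1)) (φ (ro y f1)) := (h.adj hn rp1 rq1).2 (Or.inr (SK_ro h1 h2))
  rcases A1 with a | a
  · exact k4 ((h.adj hn rp1 rq2).1 (Or.inl (a.trans (hy1 _ _ h2 k2))))
  · exact k5 ((h.adj hn rp2 rq1).1 (Or.inr ((hx2 _ _ k1 h1).trans a)))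

lemma Good.ty_dual (hn : 3 ≤ n) (h : Good φ) (H : ∀ x, Ty1 φ x) {x y f : Vc n}
    (h1 : f ⬝ᵥ x = 1) (h2 : f ⬝ᵥ y = 1) : SK (φ (ro x f)) (φ (ro y f)) := by
  have hx := (ne_zero_of_dot one_ne_zero h1).1
  by_cases hpar : ∀ c : ℂ, y ≠ c • x
  · obtain ⟨f2, g2, k1, k2, k3, k4, k5⟩ := conf_exists hx hpar h1 h2
    have rp1 : R1 (ro x f) := ⟨_, _, h1, rfl⟩
    have rp2 : R1 (ro x f2) := ⟨_, _, k1, rfl⟩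
    have rq1 : R1 (ro y f) := ⟨_, _, h2, rfl⟩
    have A1 : Adj (φ (ro x f)) (φ (ro y f)) := (h.adj hn rp1 rq1).2 (Or.inr (SK_ro h1 h2))
    rcases A1 with a | a
    · exact absurd ((h.adj hn rp2 rq1).1 (Or.inl ((H x _ _ k1 h1).trans a))) k5
    · exact a
  · push Not at hpar
    obtain ⟨c, rfl⟩ := hpar
    have : c = 1 := by rw [dotProduct_smul, h1] at h2; simpa using h2
    rw [this, one_smul]
    have := (h.map_R1 (P := ro x f) ⟨_, _, h1, rfl⟩).idem
    exact ⟨this, this⟩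

lemma SK.form {x f : Vc n} {Q : Mt n} (hf : f ⬝ᵥ x = 1) (h : SK (ro x f) Q) :
    ∃ y, f ⬝ᵥ y = 1 ∧ Q = ro y f := by
  obtain ⟨g, hg, e⟩ := SI.form (x := f) (f := x) (Q := Qᵀ) (by rw [dotProduct_comm, hf]) (by
    rw [← ro_transpose]; exact SI_transpose.2 h)
  refine ⟨g, by rw [dotProduct_comm, hg], ?_⟩
  rw [← transpose_inj, e, ro_transpose]

structure Tau (φ : Mt n → Mt n) (τ τs : Vc n → Vc n) : Prop where
  ne : ∀ x, x ≠ 0 → τ x ≠ 0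
  nes : ∀ f, f ≠ 0 → τs f ≠ 0
  dot_ne : ∀ x f, f ⬝ᵥ x ≠ 0 → τs f ⬝ᵥ τ x ≠ 0
  dot_zero : ∀ x f, x ≠ 0 → f ≠ 0 → f ⬝ᵥ x = 0 → τs f ⬝ᵥ τ x = 0
  map : ∀ x f, f ⬝ᵥ x = 1 → φ (ro x f) = (τs f ⬝ᵥ τ x)⁻¹ • ro (τ x) (τs f)
  surj : ∀ u, u ≠ 0 → ∃ x, x ≠ 0 ∧ ∃ c : ℂ, u = c • τ x

lemma Good.exists_tau (hn : 3 ≤ n) (h : Good φ) (H : ∀ x, Ty1 φ x) : ∃ τ τs, Tau φ τ τs := by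
  have h1 : ∀ x : Vc n, ∃ u : Vc n, (x ≠ 0 → u ≠ 0 ∧ ∀ f : Vc n, f ⬝ᵥ x = 1 →
      ∃ g, g ⬝ᵥ u = 1 ∧ φ (ro x f) = ro u g) := by
    intro x
    by_cases hx : x = 0
    · exact ⟨0, fun h => absurd hx h⟩
    obtain ⟨f, hf⟩ := exists_dual1 hx
    obtain ⟨u, g, hg, e⟩ := h.map_R1 (P := ro x f) ⟨_, _, hf, rfl⟩
    refine ⟨u, fun _ => ⟨(ne_zero_of_dot one_ne_zero hg).1, fun f' hf' => ?_⟩⟩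
    have := H x f f' hf hf'
    rw [e] at this
    exact this.form hg
  have h2 : ∀ f : Vc n, ∃ g : Vc n, (f ≠ 0 → g ≠ 0 ∧ ∀ x : Vc n, f ⬝ᵥ x = 1 →
      ∃ u, g ⬝ᵥ u = 1 ∧ φ (ro x f) = ro u g) := by
    intro f
    by_cases hf0 : f = 0
    · exact ⟨0, fun h => absurd hf0 h⟩
    obtain ⟨x, hf⟩ := exists_dual1' hf0
    obtain ⟨u, g, hg, e⟩ := h.map_R1 (P := ro x f) ⟨_, _, hf, rfl⟩
    refine ⟨g, fun _ => ⟨(ne_zero_of_dot one_ne_zero hg).2, fun x' hf' => ?_⟩⟩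
    have := h.ty_dual hn H hf hf'
    rw [e] at this
    exact this.form hg
  choose τ hτ using h1
  choose τs hτs using h2
  have main : ∀ x f : Vc n, f ⬝ᵥ x = 1 → τs f ⬝ᵥ τ x ≠ 0 ∧
      φ (ro x f) = (τs f ⬝ᵥ τ x)⁻¹ • ro (τ x) (τs f) := by
    intro x f hf
    obtain ⟨hx0, hf0⟩ := ne_zero_of_dot one_ne_zero hf
    obtain ⟨a1, a2⟩ := hτ x hx0
    obtain ⟨b1, b2⟩ := hτs f hf0
    obtain ⟨g, hg, e1⟩ := a2 f hf
    obtain ⟨u, hu, e2⟩ := b2 x hf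
    have e3 : τ x = (τs f ⬝ᵥ τ x) • u := by
      rw [← ro_mulVec, ← e2, e1, ro_mulVec, hg, one_smul]
    have e4 : τs f ⬝ᵥ τ x ≠ 0 := by
      intro h; rw [h, zero_smul] at e3; exact a1 e3
    refine ⟨e4, ?_⟩
    have e5 : u = (τs f ⬝ᵥ τ x)⁻¹ • τ x := by
      have := congrArg (fun v => (τs f ⬝ᵥ τ x)⁻¹ • v) e3
      simp only [smul_smul, inv_mul_cancel₀ e4, one_smul] at this
      exact this.symm
    rw [e2]
    nth_rewrite 1 [e5]
    rw [ro_smul_left]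
  have dne : ∀ x f : Vc n, f ⬝ᵥ x ≠ 0 → τs f ⬝ᵥ τ x ≠ 0 := by
    intro x f hfx
    obtain ⟨hx0, hf0⟩ := ne_zero_of_dot hfx rfl
    obtain ⟨a1, a2⟩ := hτ x hx0
    obtain ⟨b1, b2⟩ := hτs f hf0
    obtain ⟨g, hg, e1⟩ := a2 ((f ⬝ᵥ x)⁻¹ • f) (by rw [smul_dotProduct, smul_eq_mul, inv_mul_cancel₀ hfx])
    obtain ⟨u, hu, e2⟩ := b2 ((f ⬝ᵥ x)⁻¹ • x) (by rw [dotProduct_smul, smul_eq_mul, inv_mul_cancel₀ hfx])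
    rw [ro_smul_right, ← ro_smul_left, e2] at e1
    have e3 : τ x = (τs f ⬝ᵥ τ x) • u := by
      rw [← ro_mulVec, e1, ro_mulVec, hg, one_smul]
    intro h; rw [h, zero_smul] at e3; exact a1 e3
  refine ⟨τ, τs, fun x hx => (hτ x hx).1, fun f hf => (hτs f hf).1, dne, ?_,
    fun x f hf => (main x f hf).2, ?_⟩
  · intro y f hy hf hfy
    obtain ⟨x, hx⟩ := exists_dual1' hf
    have hpar : ∀ c : ℂ, x ≠ c • y := by
      rintro c rfl
      rw [dotProduct_smul, hfy] at hx; simp at hx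
    obtain ⟨g, hg1, hg2⟩ := exists_dual2 hy hpar 1 0
    have ho : Orth (ro x f) (ro y g) := by
      constructor <;> rw [ro_mul_ro] <;> simp [hfy, hg2]
    have ho' := ((h.orth hn ⟨_, _, hx, rfl⟩ ⟨_, _, hg1, rfl⟩).2 ho).1
    obtain ⟨m1, m2⟩ := main x f hx
    obtain ⟨m3, m4⟩ := main y g hg1
    rw [m2, m4, smul_mul_smul_comm, ro_mul_ro, smul_smul, smul_eq_zero] at ho'
    rcases ho' with ho' | ho'
    · simpa [m1, m3] using ho'
    · rcases ro_eq_zero.1 ho' with k | k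
      · rw [k] at m1; simp at m1
      · rw [k] at m3; simp at m3
  · intro u hu
    obtain ⟨g, hg⟩ := exists_dual1 hu
    obtain ⟨X, ⟨x, f, hf, rfl⟩, e⟩ := h.surj_R1 (Q := ro u g) ⟨_, _, hg, rfl⟩
    refine ⟨x, (ne_zero_of_dot one_ne_zero hf).1, (τs f ⬝ᵥ τ x)⁻¹ * (τs f ⬝ᵥ u), ?_⟩
    obtain ⟨m1, m2⟩ := main x f hf
    rw [m2] at e
    have := congrArg (fun X => X *ᵥ u) e
    simp only [smul_mulVec, ro_mulVec, hg, one_smul, smul_smul] at this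
    exact this.symm

end JP

namespace JP

variable {n : ℕ}

structure TauS (τ τs : Vc n → Vc n) : Prop where
  ne : ∀ x, x ≠ 0 → τ x ≠ 0
  nes : ∀ f, f ≠ 0 → τs f ≠ 0
  dot_ne : ∀ x f, f ⬝ᵥ x ≠ 0 → τs f ⬝ᵥ τ x ≠ 0
  dot_zero : ∀ x f, x ≠ 0 → f ≠ 0 → f ⬝ᵥ x = 0 → τs f ⬝ᵥ τ x = 0
  surj : ∀ u, u ≠ 0 → ∃ x, x ≠ 0 ∧ ∃ c : ℂ, u = c • τ x

lemma supp2 {h v : Vc n} {i j : Fin n} (hij : i ≠ j) (hs : ∀ k, k ≠ i → k ≠ j → h k = 0) :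
    h ⬝ᵥ v = h i * v i + h j * v j := by
  have : h = Pi.single i (h i) + Pi.single j (h j) := by
    ext k
    by_cases h1 : k = i
    · subst h1; simp [hij]
    · by_cases h2 : k = j
      · subst h2; simp [h1]
      · simp [h1, h2, hs k h1 h2]
  conv_lhs => rw [this]
  simp [add_dotProduct]

lemma supp3 {h v : Vc n} {i j l : Fin n} (hij : i ≠ j) (hil : i ≠ l) (hjl : j ≠ l)
    (hs : ∀ k, k ≠ i → k ≠ j → k ≠ l → h k = 0) :
    h ⬝ᵥ v = h i * v i + h j * v j + h l * v l := by
  have : h = Pi.single i (h i) + Pi.single j (h j) + Pi.single l (h l) := by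
    ext k
    by_cases h1 : k = i
    · subst h1; simp [hij, hil]
    · by_cases h2 : k = j
      · subst h2; simp [h1, hjl]
      · by_cases h3 : k = l
        · subst h3; simp [h1, h2]
        · simp [h1, h2, h3, hs k h1 h2 h3]
  conv_lhs => rw [this]
  simp [add_dotProduct]

lemma ftpg (hn : 3 ≤ n) {τ τs : Vc n → Vc n} (H : TauS τ τs)
    (he : ∀ i, ∃ c : ℂ, τ (Pi.single i 1) = c • Pi.single i 1)
    (h1 : ∃ c : ℂ, τ 1 = c • 1) :
    ∃ σ : ℂ ≃+* ℂ, (∀ x, x ≠ 0 → ∃ c : ℂ, τ x = c • (⇑σ ∘ x)) ∧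
      (∀ f, f ≠ 0 → ∃ c : ℂ, τs f = c • (⇑σ ∘ f)) := by
  obtain ⟨i0, i1, i2, h01, h02, h12⟩ : ∃ i0 i1 i2 : Fin n, i0 ≠ i1 ∧ i0 ≠ i2 ∧ i1 ≠ i2 :=
    ⟨⟨0, by omega⟩, ⟨1, by omega⟩, ⟨2, by omega⟩, by simp, by simp, by simp⟩
  have h10 := h01.symm
  have h20 := h02.symm
  have h21 := h12.symm
  have ene : ∀ i : Fin n, (Pi.single i 1 : Vc n) ≠ 0 := fun i => by simp
  have one_ne : (1 : Vc n) ≠ 0 := fun h => by simpa using congrFun h i0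
  -- coordinates of functionals
  have hs0 : ∀ (f : Vc n) (k : Fin n), f ≠ 0 → f k = 0 → τs f k = 0 := by
    intro f k hf hk
    obtain ⟨c, hc⟩ := he k
    have hc0 : c ≠ 0 := by rintro rfl; rw [zero_smul] at hc; exact H.ne _ (ene k) hc
    have := H.dot_zero (Pi.single k 1) f (ene k) hf (by simpa using hk)
    rw [hc, dotProduct_smul] at this
    simpa [hc0] using this
  have hs1 : ∀ (f : Vc n) (k : Fin n), f k ≠ 0 → τs f k ≠ 0 := by
    intro f k hk h
    obtain ⟨c, hc⟩ := he k
    have := H.dot_ne (Pi.single k 1) f (by simpa using hk)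
    rw [hc, dotProduct_smul] at this
    simp [h] at this
  have t0 : ∀ (x : Vc n) (k : Fin n), x ≠ 0 → x k = 0 → τ x k = 0 := by
    intro x k hx hk
    have := H.dot_zero x (Pi.single k 1) hx (ene k) (by simpa using hk)
    have e : τs (Pi.single k 1) = Pi.single k (τs (Pi.single k 1) k) := by
      ext j
      by_cases hj : j = k
      · subst hj; simp
      · simp only [Pi.single_eq_of_ne hj]; exact hs0 _ _ (ene k) (by simp [hj])
    rw [e, single_dotProduct] at this
    exact (mul_eq_zero.1 this).resolve_left (hs1 _ _ (by simp))
  have t1 : ∀ (x : Vc n) (k : Fin n), x k ≠ 0 → τ x k ≠ 0 := by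
    intro x k hk h
    have := H.dot_ne x (Pi.single k 1) (by simpa using hk)
    have e : τs (Pi.single k 1) = Pi.single k (τs (Pi.single k 1) k) := by
      ext j
      by_cases hj : j = k
      · subst hj; simp
      · simp only [Pi.single_eq_of_ne hj]; exact hs0 _ _ (ene k) (by simp [hj])
    rw [e, single_dotProduct, h, mul_zero] at this
    exact this rfl
  have teq : ∀ (x : Vc n) (i j : Fin n), x ≠ 0 → i ≠ j → x i = x j → τ x i = τ x j := by
    intro x i j hx hij hxx
    have fne : (Pi.single i 1 - Pi.single j 1 : Vc n) ≠ 0 := fun h => by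
      simpa [hij] using congrFun h i
    have supp : ∀ k, k ≠ i → k ≠ j → τs (Pi.single i 1 - Pi.single j 1) k = 0 :=
      fun k hi hj => hs0 _ _ fne (by simp [hi, hj])
    have a1 := H.dot_zero 1 _ one_ne fne (by simp [sub_dotProduct])
    have a2 := H.dot_zero x _ hx fne (by simp [sub_dotProduct, hxx])
    have a3 := hs1 (Pi.single i 1 - Pi.single j 1) i (by simp [hij])
    rw [supp2 hij supp] at a1 a2
    obtain ⟨c, hc⟩ := h1
    have hc0 : c ≠ 0 := by rintro rfl; rw [zero_smul] at hc; exact H.ne _ one_ne hc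
    rw [hc] at a1
    simp only [Pi.smul_apply, Pi.one_apply, smul_eq_mul, mul_one, ← add_mul] at a1
    have a4 := (mul_eq_zero.1 a1).resolve_right hc0
    have : τs (Pi.single i 1 - Pi.single j 1) i * (τ x i - τ x j) = 0 := by
      linear_combination a2 - τ x j * a4
    exact sub_eq_zero.1 ((mul_eq_zero.1 this).resolve_left a3)
  -- definition of sigma
  have hsj : ∀ (j : Fin n), j ≠ i0 → ∃ s : ℂ → ℂ, ∀ x : Vc n, x i0 = 1 → τ x j = s (x j) * τ x i0 := by
    intro j hj
    refine ⟨fun t => - τs (t • Pi.single i0 1 - Pi.single j 1) i0 /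
      τs (t • Pi.single i0 1 - Pi.single j 1) j, fun x hx => ?_⟩
    have hx0 : x ≠ 0 := by rintro rfl; simp at hx
    have fne : (x j • Pi.single i0 1 - Pi.single j 1 : Vc n) ≠ 0 := fun h => by
      simpa [hj] using congrFun h j
    have supp : ∀ k, k ≠ i0 → k ≠ j → τs (x j • Pi.single i0 1 - Pi.single j 1) k = 0 :=
      fun k hi hj => hs0 _ _ fne (by simp [hi, hj])
    have a2 := H.dot_zero x _ hx0 fne (by simp [sub_dotProduct, hx])
    have a3 := hs1 (x j • Pi.single i0 1 - Pi.single j 1) j (by simp [hj])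
    rw [supp2 hj.symm supp] at a2
    field_simp
    linear_combination a2
  obtain ⟨s, hs⟩ := hsj i1 h10
  have x1ne : ∀ x : Vc n, x i0 = 1 → x ≠ 0 := fun x hx => by rintro rfl; simp at hx
  have tx0 : ∀ x : Vc n, x i0 = 1 → τ x i0 ≠ 0 := fun x hx => t1 x i0 (by simp [hx])
  have s0 : s 0 = 0 := by
    have := hs (Pi.single i0 1) (by simp)
    rw [t0 _ i1 (ene i0) (by simp [h10])] at this
    simp only [Pi.single_eq_of_ne h10] at this
    exact (mul_eq_zero.1 this.symm).resolve_right (tx0 _ (by simp))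
  have s1 : s 1 = 1 := by
    have := hs 1 (by simp)
    rw [teq 1 i1 i0 one_ne h10 rfl] at this
    simp only [Pi.one_apply] at this
    exact (mul_right_cancel₀ (tx0 1 (by simp)) (by rw [← this, one_mul]))
  have key : ∀ (x : Vc n) (j : Fin n), x i0 = 1 → τ x j = s (x j) * τ x i0 := by
    intro x j hx
    by_cases hj : j = i0
    · rw [hj, hx, s1, one_mul]
    by_cases hj1 : j = i1
    · rw [hj1]; exact hs x hx
    obtain ⟨s', hs'⟩ := hsj j hj
    have hj' := Ne.symm hj
    have hj1' := Ne.symm hj1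
    have b1 := hs (Pi.single i0 1 + Pi.single i1 (x j) + Pi.single j (x j)) (by simp [h01, hj'])
    have b2 := hs' (Pi.single i0 1 + Pi.single i1 (x j) + Pi.single j (x j)) (by simp [h01, hj'])
    rw [teq _ i1 j (x1ne _ (by simp [h01, hj'])) hj1' (by simp [h10, hj1', hj1, hj]), b2] at b1
    have b3 := mul_right_cancel₀ (tx0 _ (by simp [h01, hj'])) b1
    simp only [Pi.add_apply, Pi.single_eq_of_ne hj, Pi.single_eq_of_ne hj1, Pi.single_eq_same,
      Pi.single_eq_of_ne h10, Pi.single_eq_of_ne hj1', zero_add, add_zero] at b3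
    rw [hs' x hx, b3]
  have D : ∀ (x f : Vc n), x i0 = 1 → f ≠ 0 → f ⬝ᵥ x = 0 → τs f ⬝ᵥ (s ∘ x) = 0 := by
    intro x f hx hf hfx
    have := H.dot_zero x f (x1ne x hx) hf hfx
    have e : τ x = τ x i0 • (s ∘ x) := by
      ext j; rw [key x j hx]; simp [mul_comm]
    rw [e, dotProduct_smul] at this
    exact (smul_eq_zero.1 this).resolve_left (tx0 x hx)
  have sadd : ∀ a b, s (a + b) = s a + s b := by
    intro a b
    obtain ⟨f, hf⟩ : ∃ f : Vc n, f = Pi.single i2 1 - Pi.single i1 1 - Pi.single i0 b := ⟨_, rfl⟩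
    have f2 : f i2 = 1 := by simp [hf, h20, h21]
    have fne : f ≠ 0 := fun h => by rw [h] at f2; simp at f2
    have supp : ∀ k, k ≠ i0 → k ≠ i1 → k ≠ i2 → τs f k = 0 :=
      fun k k0 k1 k2 => hs0 _ _ fne (by simp [hf, k0, k1, k2])
    have f2' := hs1 f i2 (by simp [f2])
    have a1 := D (Pi.single i0 1 + Pi.single i2 b) f (by simp [h02]) fne (by
      simp [hf, sub_dotProduct, dotProduct_add, h01, h02, h12, h10, h20, h21])
    have a2 := D (Pi.single i0 1 + Pi.single i1 a + Pi.single i2 (a + b)) f (by simp [h01, h02]) fne (by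
      simp [hf, sub_dotProduct, dotProduct_add, h01, h02, h12, h10, h20, h21])
    have w0 : (Pi.single i1 1 + Pi.single i2 1 : Vc n) ≠ 0 := fun h => by
      simpa [h12] using congrFun h i1
    have a3 := H.dot_zero (Pi.single i1 1 + Pi.single i2 1) f w0 fne (by
      simp [hf, sub_dotProduct, dotProduct_add, h01, h02, h12, h10, h20, h21])
    have a4 := teq (Pi.single i1 1 + Pi.single i2 1) i1 i2 w0 h12 (by simp [h12, h21])
    have a5 := t0 (Pi.single i1 1 + Pi.single i2 1) i0 w0 (by simp [h01, h02])
    have a6 := t1 (Pi.single i1 1 + Pi.single i2 1) i1 (by simp [h12])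
    rw [supp3 h01 h02 h12 supp] at a1 a2 a3
    rw [a5, ← a4, mul_zero, zero_add, ← add_mul] at a3
    have a7 := (mul_eq_zero.1 a3).resolve_right a6
    simp [h01, h02, h12, h10, h20, h21, s0, s1] at a1 a2
    have : τs f i2 * (s (a + b) - (s a + s b)) = 0 := by
      linear_combination a2 - a1 - s a * a7
    exact sub_eq_zero.1 ((mul_eq_zero.1 this).resolve_left f2')
  have smul' : ∀ a b, s (a * b) = s a * s b := by
    intro m a
    obtain ⟨f, hf⟩ : ∃ f : Vc n, f = Pi.single i2 1 - Pi.single i1 m := ⟨_, rfl⟩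
    have f2 : f i2 = 1 := by simp [hf, h20, h21]
    have fne : f ≠ 0 := fun h => by rw [h] at f2; simp at f2
    have supp : ∀ k, k ≠ i1 → k ≠ i2 → τs f k = 0 :=
      fun k k1 k2 => hs0 _ _ fne (by simp [hf, k1, k2])
    have f2' := hs1 f i2 (by simp [f2])
    have a1 := D (Pi.single i0 1 + Pi.single i1 1 + Pi.single i2 m) f (by simp [h01, h02]) fne (by
      simp [hf, sub_dotProduct, dotProduct_add, h01, h02, h12, h10, h20, h21])
    have a2 := D (Pi.single i0 1 + Pi.single i1 a + Pi.single i2 (m * a)) f (by simp [h01, h02]) fne (by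
      simp [hf, sub_dotProduct, dotProduct_add, h01, h02, h12, h10, h20, h21])
    rw [supp2 h12 supp] at a1 a2
    simp [h01, h02, h12, h10, h20, h21, s0, s1] at a1 a2
    have : τs f i2 * (s (m * a) - s m * s a) = 0 := by
      linear_combination a2 - s a * a1
    exact sub_eq_zero.1 ((mul_eq_zero.1 this).resolve_left f2')
  let S : ℂ →+* ℂ := { toFun := s, map_one' := s1, map_mul' := smul', map_zero' := s0, map_add' := sadd }
  have hS : ∀ a, s a = S a := fun a => rfl
  have sne : ∀ a, a ≠ 0 → S a ≠ 0 := fun a ha => by simpa using ha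
  have F : ∀ f : Vc n, f ≠ 0 → ∃ c : ℂ, τs f = c • (s ∘ f) := by
    intro f hf
    by_cases hj : ∃ j, j ≠ i0 ∧ f j ≠ 0
    · obtain ⟨j, hj, hfj⟩ := hj
      have hj' := hj.symm
      have sj := sne _ hfj
      have a0 := D (Pi.single i0 1 + Pi.single j (-(f i0 / f j))) f (by simp [hj']) hf (by
        simp [dotProduct_add]; field_simp; ring)
      have e0 : s ∘ (Pi.single i0 1 + Pi.single j (-(f i0 / f j)) : Vc n)
          = Pi.single i0 1 + Pi.single j (S (-(f i0 / f j))) := by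
        ext k
        by_cases k0 : k = i0
        · subst k0; simp [hj', s1]
        · by_cases kj : k = j
          · subst kj; simp [hj, hS]
          · simp [k0, kj, s0]
      rw [e0] at a0
      simp [dotProduct_add] at a0
      refine ⟨τs f j / S (f j), ?_⟩
      ext k
      simp only [Pi.smul_apply, Function.comp, hS, smul_eq_mul]
      by_cases kj : k = j
      · subst kj; field_simp
      by_cases k0 : k = i0
      · subst k0; field_simp; field_simp at a0; linear_combination a0
      have kj' := Ne.symm kj
      have k0' := Ne.symm k0
      have a1 := D (Pi.single i0 1 + Pi.single k 1 + Pi.single j (-((f i0 + f k) / f j))) f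
        (by simp [hj', k0']) hf (by
        simp [dotProduct_add]; field_simp; ring)
      have e1 : s ∘ (Pi.single i0 1 + Pi.single k 1 + Pi.single j (-((f i0 + f k) / f j)) : Vc n)
          = Pi.single i0 1 + Pi.single k 1 + Pi.single j (S (-((f i0 + f k) / f j))) := by
        ext l
        by_cases l0 : l = i0
        · subst l0; simp [hj', s1, k0']
        · by_cases lj : l = j
          · subst lj; simp [hj, hS, kj']
          · by_cases lk : l = k
            · subst lk; simp [l0, lj, s1]
            · simp [l0, lj, lk, s0]
      rw [e1] at a1
      simp [dotProduct_add] at a1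
      field_simp; field_simp at a0 a1; linear_combination a1 - a0
    · push Not at hj
      have f0 : f i0 ≠ 0 := by
        intro h; apply hf; ext j
        by_cases k : j = i0
        · rw [k, h]; rfl
        · rw [hj j k]; rfl
      have sj := sne _ f0
      refine ⟨τs f i0 / S (f i0), ?_⟩
      ext j
      simp only [Pi.smul_apply, Function.comp, hS, smul_eq_mul]
      by_cases k : j = i0
      · rw [k]; field_simp
      · rw [hj j k, map_zero, mul_zero]; exact hs0 f j hf (hj j k)
  have X : ∀ x : Vc n, x ≠ 0 → ∃ c : ℂ, τ x = c • (s ∘ x) := by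
    intro x hx
    obtain ⟨k, hk⟩ : ∃ k, x k ≠ 0 := by
      by_contra h; push Not at h; exact hx (funext h)
    have sk := sne _ hk
    refine ⟨τ x k / S (x k), ?_⟩
    ext j
    simp only [Pi.smul_apply, Function.comp, hS, smul_eq_mul]
    by_cases hjk : j = k
    · rw [hjk]; field_simp
    have hkj := Ne.symm hjk
    obtain ⟨f, hf⟩ : ∃ f : Vc n, f = Pi.single j (x k) - Pi.single k (x j) := ⟨_, rfl⟩
    have fne : f ≠ 0 := fun h => by
      have := congrFun h j
      simp [hf, hjk] at this; exact hk this
    have a1 := H.dot_zero x f hx fne (by simp [hf, sub_dotProduct]; ring)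
    obtain ⟨c, hc⟩ := F f fne
    have hc0 : c ≠ 0 := by rintro rfl; rw [zero_smul] at hc; exact H.nes f fne hc
    have e1 : s ∘ f = Pi.single j (S (x k)) - Pi.single k (S (x j)) := by
      ext l
      by_cases lj : l = j
      · subst lj; simp [hf, hjk, hS]
      · by_cases lk : l = k
        · subst lk; simp [hf, lj, hS]
        · simp [hf, lj, lk, s0]
    rw [hc, smul_dotProduct, e1, sub_dotProduct, single_dotProduct, single_dotProduct] at a1
    have a2 := (smul_eq_zero.1 a1).resolve_left hc0
    field_simp; linear_combination a2
  have Ssurj : Function.Surjective S := by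
    intro t
    obtain ⟨x, hx, c, hc⟩ := H.surj (Pi.single i0 1 + Pi.single i1 t) (fun h => by
      simpa [h01] using congrFun h i0)
    obtain ⟨d, hd⟩ := X x hx
    rw [hd, smul_smul] at hc
    have c0 := congrFun hc i0
    have c1 := congrFun hc i1
    simp [h01, h10, hS] at c0 c1
    have x0 : x i0 ≠ 0 := by intro h; rw [h] at c0; simp at c0
    have sx := sne _ x0
    refine ⟨x i1 / x i0, ?_⟩
    rw [map_div₀, c1]
    field_simp
    linear_combination (S (x i1)) * c0
  exact ⟨RingEquiv.ofBijective S ⟨S.injective, Ssurj⟩, X, F⟩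

end JP

namespace JP

variable {n : ℕ}

lemma TauS.conj {τ τs : Vc n → Vc n} (H : TauS τ τs) {T T' : Mt n} (h : T * T' = 1) (h' : T' * T = 1) :
    TauS (fun x => T' *ᵥ τ x) (fun f => τs f ᵥ* T) := by
  have hd : ∀ x f, (τs f ᵥ* T) ⬝ᵥ (T' *ᵥ τ x) = τs f ⬝ᵥ τ x := by
    intro x f; rw [vm_dot, mulVec_mulVec, h, one_mulVec]
  refine ⟨?_, ?_, ?_, ?_, ?_⟩
  · intro x hx h0
    apply H.ne x hx
    have := congrArg (fun v => T *ᵥ v) h0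
    simpa [mulVec_mulVec, h] using this
  · intro x hx h0
    apply H.nes x hx
    have := congrArg (fun v => v ᵥ* T') h0
    simpa [vecMul_vecMul, h] using this
  · intro x f hf; rw [hd]; exact H.dot_ne x f hf
  · intro x f hx hf0 hf; rw [hd]; exact H.dot_zero x f hx hf0 hf
  · intro u hu
    obtain ⟨x, hx, c, hc⟩ := H.surj (T *ᵥ u) (by
      intro h0
      apply hu
      have := congrArg (fun v => T' *ᵥ v) h0
      simpa [mulVec_mulVec, h'] using this)
    refine ⟨x, hx, c, ?_⟩
    have := congrArg (fun v => T' *ᵥ v) hc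
    simpa [mulVec_mulVec, h', mulVec_smul] using this

lemma TauS.exists_T {τ τs : Vc n → Vc n} (H : TauS τ τs) (h3 : 3 ≤ n) : ∃ T T' : Mt n, T * T' = 1 ∧ T' * T = 1 ∧
    (∀ i, ∃ c : ℂ, T' *ᵥ τ (Pi.single i 1) = c • Pi.single i 1) ∧ ∃ c : ℂ, T' *ᵥ τ 1 = c • 1 := by
  have ene : ∀ i : Fin n, (Pi.single i 1 : Vc n) ≠ 0 := fun i => by simp
  let a : Fin n → Vc n := fun i => τ (Pi.single i 1)
  let b : Fin n → Vc n := fun i => τs (Pi.single i 1)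
  let T0 : Mt n := Matrix.of fun i j => a j i
  let B : Mt n := Matrix.of b
  have hab : ∀ i j, i ≠ j → b i ⬝ᵥ a j = 0 := fun i j hij =>
    H.dot_zero _ _ (ene j) (ene i) (by simp [hij.symm])
  have haa : ∀ i, b i ⬝ᵥ a i ≠ 0 := fun i => H.dot_ne _ _ (by simp)
  have hau : ∀ i, b i ⬝ᵥ τ 1 ≠ 0 := fun i => H.dot_ne _ _ (by simp)
  have hBT : B * T0 = diagonal fun i => b i ⬝ᵥ a i := by
    ext i j
    rw [mul_apply, diagonal_apply]
    split_ifs with hij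
    · subst hij; rfl
    · exact hab i j hij
  have hdet : B.det * T0.det ≠ 0 := by
    rw [← det_mul, hBT, det_diagonal]
    exact Finset.prod_ne_zero_iff.2 fun i _ => haa i
  let t : Vc n := fun i => (b i ⬝ᵥ τ 1) / (b i ⬝ᵥ a i)
  have ht : ∀ i, t i ≠ 0 := fun i => div_ne_zero (hau i) (haa i)
  let T : Mt n := T0 * diagonal t
  have hT : IsUnit T.det := by
    rw [det_mul, det_diagonal]
    exact isUnit_iff_ne_zero.2 (mul_ne_zero (right_ne_zero_of_mul hdet)
      (Finset.prod_ne_zero_iff.2 fun i _ => ht i))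
  have hTe : ∀ i, T *ᵥ Pi.single i 1 = t i • a i := by
    intro i
    ext k
    simp [T, T0, mul_diagonal, mulVec_single, mul_comm]
  have hT1 : T *ᵥ 1 = τ 1 := by
    have hB : IsUnit B.det := isUnit_iff_ne_zero.2 (left_ne_zero_of_mul hdet)
    have : B *ᵥ (T *ᵥ 1) = B *ᵥ τ 1 := by
      rw [mulVec_mulVec, ← mul_assoc, hBT, diagonal_mul_diagonal]
      ext i
      rw [mulVec_diagonal, Pi.one_apply, mul_one]
      simp only [t]
      rw [mul_div_cancel₀ _ (haa i)]
      rfl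
    have := congrArg (fun v => B⁻¹ *ᵥ v) this
    simpa only [mulVec_mulVec, ← mul_assoc, nonsing_inv_mul B hB, one_mul, one_mulVec] using this
  refine ⟨T, T⁻¹, mul_nonsing_inv T hT, nonsing_inv_mul T hT, fun i => ⟨(t i)⁻¹, ?_⟩, 1, ?_⟩
  · have : τ (Pi.single i 1) = T *ᵥ ((t i)⁻¹ • Pi.single i 1) := by
      rw [mulVec_smul, hTe, smul_smul, inv_mul_cancel₀ (ht i), one_smul]
    rw [this, mulVec_mulVec, nonsing_inv_mul T hT, one_mulVec]
  · rw [← hT1, mulVec_mulVec, nonsing_inv_mul T hT, one_mulVec, one_smul]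

lemma stage2 (hn : 3 ≤ n) {φ : Mt n → Mt n} (h : Good φ) (H : ∀ x, Ty1 φ x) :
    ∃ (σ : ℂ ≃+* ℂ) (T T' : Mt n), T * T' = 1 ∧ T' * T = 1 ∧
      ∀ P, R1 P → φ P = T * P.map σ * T' := by
  obtain ⟨τ, τs, K⟩ := h.exists_tau hn H
  have K' : TauS τ τs := ⟨K.ne, K.nes, K.dot_ne, K.dot_zero, K.surj⟩
  obtain ⟨T, T', h1, h2, h3, h4⟩ := K'.exists_T hn
  obtain ⟨σ, a1, a2⟩ := ftpg hn (K'.conj h1 h2) h3 h4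
  refine ⟨σ, T, T', h1, h2, ?_⟩
  rintro P ⟨x, f, hf, rfl⟩
  obtain ⟨hx0, hf0⟩ := ne_zero_of_dot one_ne_zero hf
  obtain ⟨c, hc⟩ := a1 x hx0
  obtain ⟨d, hd⟩ := a2 f hf0
  have e1 : τ x = c • (T *ᵥ (σ ∘ x)) := by
    rw [← mulVec_smul, ← hc, mulVec_mulVec, h1, one_mulVec]
  have e2 : τs f = d • ((σ ∘ f) ᵥ* T') := by
    rw [← smul_vecMul, ← hd, vecMul_vecMul, h1, vecMul_one]
  have e3 : (σ ∘ f) ⬝ᵥ (σ ∘ x) = 1 := by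
    have := congrArg σ hf
    rw [map_one] at this
    rw [← this]
    simp [dotProduct, map_sum]
  have e4 : τs f ⬝ᵥ τ x = d * c := by
    rw [e1, e2, smul_dotProduct, dotProduct_smul, vm_dot, mulVec_mulVec, h2, one_mulVec, e3]
    simp
  have e5 : (ro x f).map σ = ro (σ ∘ x) (σ ∘ f) := by
    ext i j; simp [vecMulVec_apply]
  have e6 := K.dot_ne x f (by rw [hf]; exact one_ne_zero)
  rw [K.map x f hf]
  rw [e4] at e6 ⊢
  rw [e1, e2, e5, ro_smul_left, ro_smul_right, smul_smul, smul_smul, mul_ro, ro_mul,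
    show (d * c)⁻¹ * c * d = 1 by rw [mul_assoc, mul_comm c d, inv_mul_cancel₀ e6], one_smul]

lemma rel_ringEquiv (Φ : Mt n ≃+* Mt n) (A B : Mt n) : Rel (Φ A) (Φ B) ↔ Rel A B := by
  unfold Rel
  rw [two_smul, two_smul, ← map_mul, ← map_mul, ← map_add, ← map_mul, ← map_add]
  exact Φ.injective.eq_iff

lemma Good.comp {φ : Mt n → Mt n} (h : Good φ) (Φ : Mt n ≃+* Mt n) : Good (fun A => Φ (φ A)) := by
  refine ⟨⟨?_, ?_, ?_⟩, ?_, ?_⟩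
  · intro P hP
    obtain ⟨X, hX⟩ := h.sp (Φ.symm P) (by rw [← map_mul, hP])
    exact ⟨X, by simp [hX]⟩
  · intro P hP
    obtain ⟨X, hX⟩ := h.sn (Φ.symm P) (by rw [← map_mul, hP])
    exact ⟨X, by simp [hX]⟩
  · intro X Y
    rw [rel_ringEquiv]; exact h.pres X Y
  · simp [h.one]
  · simp [h.neg_one]

def conjE (T T' : Mt n) (h : T * T' = 1) (h' : T' * T = 1) : Mt n ≃+* Mt n where
  toFun X := T * X * T'
  invFun X := T' * X * T
  left_inv X := by
    simp only
    rw [show T' * (T * X * T') * T = (T' * T) * X * (T' * T) by noncomm_ring, h', one_mul, mul_one]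
  right_inv X := by
    simp only
    rw [show T * (T' * X * T) * T' = (T * T') * X * (T * T') by noncomm_ring, h, one_mul, mul_one]
  map_mul' X Y := by
    rw [show T * X * T' * (T * Y * T') = T * X * (T' * T) * Y * T' by noncomm_ring, h', mul_one]
    noncomm_ring
  map_add' X Y := by noncomm_ring

lemma assemble1 (hn : 3 ≤ n)
    (endgame : ∀ φ : Mt n → Mt n, Good φ → (∀ P, R1 P → φ P = P) → ∀ A, φ A = A)
    {φ : Mt n → Mt n} (h : Good φ) (H : ∀ x, Ty1 φ x) :
    ∃ (σ : ℂ ≃+* ℂ) (T T' : Mt n), T * T' = 1 ∧ T' * T = 1 ∧ ∀ M, φ M = T * M.map σ * T' := by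
  obtain ⟨σ, T, T', h1, h2, h3⟩ := stage2 hn h H
  let Φ : Mt n ≃+* Mt n := (RingEquiv.mapMatrix σ).trans (conjE T T' h1 h2)
  have hΦ : ∀ M, Φ M = T * M.map σ * T' := fun M => rfl
  refine ⟨σ, T, T', h1, h2, fun M => ?_⟩
  have := endgame (fun A => Φ.symm (φ A)) (h.comp Φ.symm) (fun P hP => by
    rw [h3 P hP, ← hΦ, RingEquiv.symm_apply_apply]) M
  rw [← hΦ]
  nth_rewrite 2 [← this]
  rw [RingEquiv.apply_symm_apply]

lemma assemble2 (hn : 3 ≤ n)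
    (endgame : ∀ φ : Mt n → Mt n, Good φ → (∀ P, R1 P → φ P = P) → ∀ A, φ A = A)
    {φ : Mt n → Mt n} (h : Good φ) :
    ∃ (σ : ℂ ≃+* ℂ) (T : Mt n), IsUnit T ∧ ((∀ M, φ M = T * M.map σ * T⁻¹) ∨
      (∀ M, φ M = T * (M.map σ)ᵀ * T⁻¹)) := by
  rcases h.ty_all hn with H | H
  · obtain ⟨σ, T, T', h1, h2, h3⟩ := assemble1 hn endgame h H
    refine ⟨σ, T, IsUnit.of_mul_eq_one T' h1, Or.inl ?_⟩
    rw [inv_eq_right_inv h1]; exact h3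
  · obtain ⟨σ, T, T', h1, h2, h3⟩ := assemble1 hn endgame h.transpose (fun x f g hf hg =>
      SI_transpose.2 (H x f g hf hg))
    have e : T'ᵀ * Tᵀ = 1 := by rw [← transpose_mul, h1, transpose_one]
    refine ⟨σ, T'ᵀ, IsUnit.of_mul_eq_one Tᵀ e, Or.inr ?_⟩
    intro M
    rw [inv_eq_right_inv e]
    have := congrArg Matrix.transpose (h3 M)
    rw [transpose_transpose] at this
    rw [this, transpose_mul, transpose_mul, mul_assoc]

theorem assemble3 (hn : 3 ≤ n)
    (endgame : ∀ φ : Mt n → Mt n, Good φ → (∀ P, R1 P → φ P = P) → ∀ A, φ A = A)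
    (φ : Mt n → Mt n)
    (hrange : ∀ P : Mt n, ((P * P = P ∧ P ≠ 0) ∨ (P * P = -P ∧ P ≠ 0)) → ∃ A, φ A = P)
    (hpres : ∀ A B : Mt n,
      IsIdempotentElem ((2⁻¹ : ℂ) • (A * B + B * A)) ↔
        IsIdempotentElem ((2⁻¹ : ℂ) • (φ A * φ B + φ B * φ A))) :
    ∃ (σ : ℂ ≃+* ℂ) (T : Matrix (Fin n) (Fin n) ℂ) (lam : ℂ),
      IsUnit T ∧ (lam = 1 ∨ lam = -1) ∧
      ((∀ M : Matrix (Fin n) (Fin n) ℂ, φ M = lam • (T * M.map ⇑σ * T⁻¹)) ∨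
       (∀ M : Matrix (Fin n) (Fin n) ℂ, φ M = lam • (T * (M.map ⇑σ)ᵀ * T⁻¹))) := by
  have hp : Pre φ := pre_of_hyp φ hrange (fun A B => by rw [← rel_iff, ← rel_iff]; exact hpres A B)
  rcases hp.good with h | h
  · obtain ⟨σ, T, hT, h1⟩ := assemble2 hn endgame h
    exact ⟨σ, T, 1, hT, Or.inl rfl, h1.imp (fun h M => by rw [h M, one_smul])
      (fun h M => by rw [h M, one_smul])⟩
  · obtain ⟨σ, T, hT, h1⟩ := assemble2 hn endgame h
    exact ⟨σ, T, -1, hT, Or.inr rfl, h1.imp (fun h M => by rw [neg_one_smul, ← h M, neg_neg])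
      (fun h M => by rw [neg_one_smul, ← h M, neg_neg])⟩

end JP

namespace JP
variable {n : ℕ}

structure Fx (φ : Mt n → Mt n) : Prop extends Good φ where
  fix : ∀ x f : Vc n, f ⬝ᵥ x = 1 → φ (ro x f) = ro x f

variable {φ : Mt n → Mt n}

lemma Fx.dual (h : Fx φ) : Fx (fun A => (φ Aᵀ)ᵀ) := by
  refine ⟨⟨⟨?_, ?_, ?_⟩, ?_, ?_⟩, ?_⟩
  · intro P hP
    obtain ⟨X, hX⟩ := h.sp Pᵀ (by rw [← transpose_mul, hP])
    exact ⟨Xᵀ, by simp [hX]⟩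
  · intro P hP
    obtain ⟨X, hX⟩ := h.sn Pᵀ (by rw [← transpose_mul, hP])
    exact ⟨Xᵀ, by simp [hX]⟩
  · intro X Y
    rw [rel_transpose, ← h.pres, rel_transpose]
  · simp [h.one]
  · simp [h.neg_one]
  · intro x f hf
    simp only [ro_transpose]
    rw [h.fix f x (by rw [dotProduct_comm, hf]), ro_transpose]

lemma Fx.range1 (h : Fx φ) {P : Mt n} (hP : P * P = P) : φ P * P = P := by
  apply mat_ext; intro v
  by_cases h0 : P *ᵥ v = 0
  · rw [← mulVec_mulVec, h0, mulVec_zero]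
  obtain ⟨f, hf, hle⟩ := exists_R1_le hP h0
  have := (h.le_iff (ro_idem hf) hP).1 hle
  rw [h.fix _ _ hf] at this
  have h2 := congrArg (fun X => X *ᵥ (P *ᵥ v)) this.2
  simp only [← mulVec_mulVec, ro_mulVec, hf, one_smul] at h2
  rw [← mulVec_mulVec, h2]

lemma Fx.range2 (h : Fx φ) {P : Mt n} (hP : P * P = P) : P * φ P = φ P := by
  have hQ := (h.idem P).2 hP
  apply mat_ext; intro v
  by_cases h0 : φ P *ᵥ v = 0
  · rw [← mulVec_mulVec, h0, mulVec_zero]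
  obtain ⟨f, hf, hle⟩ := exists_R1_le hQ h0
  rw [← h.fix _ _ hf] at hle
  have := (h.le_iff (ro_idem hf) hP).2 hle
  have h2 := congrArg (fun X => X *ᵥ (φ P *ᵥ v)) this.2
  simp only [← mulVec_mulVec, ro_mulVec, hf, one_smul] at h2
  rw [← mulVec_mulVec, h2]

lemma Fx.idem_fix (h : Fx φ) {P : Mt n} (hP : P * P = P) : φ P = P := by
  have h1 := h.range2 hP
  have h2 := h.dual.range1 (P := Pᵀ) (by rw [← transpose_mul, hP])
  simp only [transpose_transpose] at h2
  rw [← transpose_mul, transpose_inj] at h2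
  rw [← h1, h2]

lemma Fx.neg_fix (h : Fx φ) {P : Mt n} (hP : P * P = P) : φ (-P) = -P := by
  have := h.neg_compl (compl_idem hP)
  rwa [h.idem_fix (compl_idem hP), sub_sub_cancel] at this

lemma Fx.anti (h : Fx φ) {P : Mt n} (hP : P * P = P) (A : Mt n) :
    A * P + P * A = 0 ↔ φ A * P + P * φ A = 0 := by
  constructor
  · intro h0
    have h1 : Rel A P := rel_of_zero h0
    have h2 : Rel A (-P) := rel_of_zero (by rw [mul_neg, neg_mul, ← neg_add, h0, neg_zero])
    rw [h.pres, h.idem_fix hP] at h1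
    rw [h.pres, h.neg_fix hP] at h2
    exact rel_pm h1 h2
  · intro h0
    have h1 : Rel (φ A) P := rel_of_zero h0
    have h2 : Rel (φ A) (-P) := rel_of_zero (by rw [mul_neg, neg_mul, ← neg_add, h0, neg_zero])
    rw [← h.idem_fix hP, ← h.pres] at h1
    rw [← h.neg_fix hP, ← h.pres] at h2
    exact rel_pm h1 h2

lemma anti_split {A P : Mt n} (hP : P * P = P) (h0 : A * P + P * A = 0) : A * P = 0 ∧ P * A = 0 := by
  have h1 : P * A * P = 0 := by
    have e := congrArg (fun X => P * X * P) h0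
    simp only [mul_add, add_mul, ← mul_assoc, mul_zero, zero_mul, hP] at e
    rw [mul_assoc (P * A), hP, ← two_smul ℂ] at e
    exact (smul_eq_zero.1 e).resolve_left (by norm_num)
  constructor
  · have e := congrArg (fun X => X * P) h0
    simpa [add_mul, mul_assoc, hP, ← mul_assoc, h1, mul_assoc A P P] using e
  · have e := congrArg (fun X => P * X) h0
    simpa [mul_add, ← mul_assoc, hP, h1] using e

/-- rank-one relation -/
lemma ro_rel {A : Mt n} {x g : Vc n} {c : ℂ} (hc : c ≠ 0) (hg : g ⬝ᵥ x = 1)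
    (h : Rel A (c • ro x g)) :
    A *ᵥ x = c⁻¹ • x ∨ g ᵥ* A = c⁻¹ • g ∨ (A *ᵥ x = 0 ∧ g ᵥ* A = 0) := by
  rw [rel_smul_iff c hc, mul_ro, ro_mul] at h
  set u := A *ᵥ x with hu
  set p := g ᵥ* A with hp
  set a := g ⬝ᵥ u with ha
  have hpx : p ⬝ᵥ x = a := by rw [hp, vm_dot]
  -- action on kernel of g
  have k1 : ∀ v, c • ((g ⬝ᵥ v) • (a • u + (p ⬝ᵥ u) • x) + (p ⬝ᵥ v) • (u + a • x))
      = (2:ℂ) • ((g ⬝ᵥ v) • u + (p ⬝ᵥ v) • x) := by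
    intro v
    have := congrArg (fun X => X *ᵥ v) h
    simp only [smul_mulVec, ← mulVec_mulVec, add_mulVec, ro_mulVec, mulVec_add, mulVec_smul] at this
    rw [hpx, hg, ← ha] at this
    linear_combination (norm := module) this
  have kx := k1 x
  rw [hg, hpx] at kx
  by_cases hca : c * a = 1
  · have hac : a = c⁻¹ := by field_simp; linear_combination hca
    by_cases hw : ∃ w, g ⬝ᵥ w = 0 ∧ p ⬝ᵥ w ≠ 0
    · obtain ⟨w, h1, h2⟩ := hw
      left
      have := k1 w
      rw [h1] at this
      have e : (c * (p ⬝ᵥ w)) • (u - c⁻¹ • x) = 0 := by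
        have e2 : (c * (p ⬝ᵥ w)) • (c⁻¹ • x) = (p ⬝ᵥ w) • x := by
          rw [smul_smul]; congr 1; field_simp
        have e3 : (c * (p ⬝ᵥ w)) • (a • x) = (p ⬝ᵥ w) • x := by
          rw [smul_smul]; congr 1; linear_combination (p ⬝ᵥ w) * hca
        rw [smul_sub, e2]
        linear_combination (norm := module) this - e3
      exact sub_eq_zero.1 ((smul_eq_zero.1 e).resolve_left (mul_ne_zero hc h2))
    · push Not at hw
      right; left
      apply vec_ext'; intro v
      have := hw (v - (g ⬝ᵥ v) • x) (by simp [dotProduct_sub, dotProduct_smul, hg])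
      rw [dotProduct_sub, dotProduct_smul, hpx, hac] at this
      rw [smul_dotProduct]
      simp only [smul_eq_mul] at *
      linear_combination this
  · right; right
    have h1 : (2 * (c * a - 1)) • u = (2 * a - c * (p ⬝ᵥ u + a ^ 2)) • x := by
      linear_combination (norm := module) kx
    have h2 : (2 * (c * a - 1)) * a = (2 * a - c * (p ⬝ᵥ u + a ^ 2)) := by
      have := congrArg (fun w => g ⬝ᵥ w) h1
      simpa [dotProduct_smul, hg, ← ha] using this
    have hne : (2 * (c * a - 1)) ≠ 0 := mul_ne_zero (by norm_num) (sub_ne_zero.2 hca)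
    have hu' : u = a • x := by
      rw [← h2, mul_smul _ a] at h1
      exact smul_right_injective _ hne h1
    have hpu : p ⬝ᵥ u = a * a := by rw [hu', dotProduct_smul, hpx, smul_eq_mul]
    have ha0 : a = 0 := by
      rw [hpu] at h2
      have : a * (c * a - 1) = 0 := by linear_combination h2 / 4
      exact (mul_eq_zero.1 this).resolve_right (sub_ne_zero.2 hca)
    rw [ha0, zero_smul] at hu'
    refine ⟨hu', ?_⟩
    apply vec_ext'; intro v
    have := k1 v
    rw [ha0, hu'] at this
    have := congrArg (fun w => g ⬝ᵥ w) this
    simpa [dotProduct_smul, hg] using this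

lemma rel_ro_of_eig {A : Mt n} {x g : Vc n} {c : ℂ} (hc : c ≠ 0) (hg : g ⬝ᵥ x = 1)
    (hA : A *ᵥ x = c⁻¹ • x) : Rel A (c • ro x g) := by
  rw [rel_smul_iff c hc, mul_ro, ro_mul, hA, ro_smul_left, ← ro_smul_right, ← ro_add_right, ro_mul_ro,
    smul_smul]
  congr 1
  rw [add_dotProduct, smul_dotProduct, vm_dot, hA, dotProduct_smul, hg]
  simp only [smul_eq_mul]; field_simp; norm_num

lemma Fx.smul_P (h : Fx φ) {x g : Vc n} (hg : g ⬝ᵥ x = 1) {l : ℂ} (hl : l ≠ 0) :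
    ∃ c : ℂ, c ≠ 0 ∧ φ (l • ro x g) = c • ro x g := by
  have hP := ro_idem hg
  have hP' := compl_idem hP
  set P := ro x g with hPd
  have h0 : (l • P) * (1 - P) + (1 - P) * (l • P) = 0 := by
    simp [mul_sub, sub_mul, hP]
  have h1 := anti_split hP' ((h.anti hP' _).1 h0)
  have h2 : φ (l • P) = P * φ (l • P) * P := by
    have a1 := h1.1
    have a2 := h1.2
    rw [mul_sub, mul_one, sub_eq_zero] at a1
    rw [sub_mul, one_mul, sub_eq_zero] at a2
    rw [← a2, ← a1]
  refine ⟨g ⬝ᵥ (φ (l • P) *ᵥ x), ?_, ?_⟩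
  swap
  · conv_lhs => rw [h2]
    rw [hPd, mul_assoc, mul_ro, ro_mul_ro]
  · intro hz
    have : φ (l • P) = 0 := by
      rw [h2]
      conv_lhs => rw [hPd, mul_assoc, mul_ro, ro_mul_ro]
      rw [hPd] at hz
      rw [hz, zero_smul]
    have := h.toPre.eq_zero this
    rcases smul_eq_zero.1 this with h | h
    · exact hl h
    · rw [ro_eq_zero] at h
      have := ne_zero_of_dot one_ne_zero hg
      tauto

lemma Fx.eig0 (h : Fx φ) {A : Mt n} {x : Vc n} {m : ℂ} (hm : m ≠ 0) (hA : A *ᵥ x = m • x)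
    {g : Vc n} (hg : g ⬝ᵥ x = 1) {c : ℂ} (hc : φ (m⁻¹ • ro x g) = c • ro x g) :
    φ A *ᵥ x = c⁻¹ • x := by
  obtain ⟨hx, hg0⟩ := ne_zero_of_dot one_ne_zero hg
  set B := φ A with hB
  have key : ∀ g : Vc n, g ⬝ᵥ x = 1 → ∀ c : ℂ, φ (m⁻¹ • ro x g) = c • ro x g → c ≠ 0 →
      B *ᵥ x = c⁻¹ • x ∨ g ᵥ* B = c⁻¹ • g ∨ (B *ᵥ x = 0 ∧ g ᵥ* B = 0) := by
    intro g hg c hc hc0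
    have : Rel A (m⁻¹ • ro x g) := rel_ro_of_eig (inv_ne_zero hm) hg (by rw [inv_inv, hA])
    rw [h.pres, hc] at this
    exact ro_rel hc0 hg this
  have ex := fun g (hg : g ⬝ᵥ x = 1) => h.smul_P hg (inv_ne_zero hm)
  by_cases h0 : B *ᵥ x = 0
  · exfalso
    have k : ∀ g : Vc n, g ⬝ᵥ x = 1 → g ᵥ* B = 0 := by
      intro g hg
      obtain ⟨c, hc0, hc⟩ := ex g hg
      rcases key g hg c hc hc0 with e | e | e
      · rw [h0] at e
        exact absurd ((smul_eq_zero.1 e.symm).resolve_left (inv_ne_zero hc0)) hx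
      · have := congrArg (fun w => w ⬝ᵥ x) e
        simp only [vm_dot, h0, smul_dotProduct, hg, dotProduct_zero, smul_eq_mul, mul_one] at this
        exact absurd this.symm (inv_ne_zero hc0)
      · exact e.2
    have hB0 : B = 0 := by
      apply mat_ext'; intro v
      have e := k (v + (1 - v ⬝ᵥ x) • g) (by simp [add_dotProduct, smul_dotProduct, hg])
      rw [add_vecMul, smul_vecMul, k g hg] at e
      simpa using e
    have := h.toPre.eq_zero hB0
    rw [this, zero_mulVec] at hA
    exact hx ((smul_eq_zero.1 hA.symm).resolve_left hm)
  by_cases h1 : ∃ b : ℂ, B *ᵥ x = b • x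
  · obtain ⟨b, hb⟩ := h1
    obtain ⟨c', hc0, hc'⟩ := ex g hg
    have : c = c' := by
      rw [hc'] at hc
      have := congrArg (fun X => g ⬝ᵥ (X *ᵥ x)) hc
      simpa [smul_mulVec, ro_mulVec, hg] using this.symm
    subst this
    rcases key g hg c hc hc0 with e | e | e
    · exact e
    · have := congrArg (fun w => w ⬝ᵥ x) e
      simp only [vm_dot, hb, smul_dotProduct, dotProduct_smul, hg, dotProduct_zero, smul_eq_mul, mul_one] at this
      rw [hb, this]
    · exact absurd e.1 h0
  · push Not at h1
    exfalso
    obtain ⟨g', h2, h3⟩ := exists_dual2 hx h1 1 0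
    obtain ⟨c', hc0, hc'⟩ := ex g' h2
    rcases key g' h2 c' hc' hc0 with e | e | e
    · exact h1 _ e
    · have := congrArg (fun w => w ⬝ᵥ x) e
      simp only [vm_dot, h3, smul_dotProduct, dotProduct_smul, h2, dotProduct_zero, smul_eq_mul, mul_one] at this
      exact inv_ne_zero hc0 this.symm
    · exact h0 e.1

lemma Fx.eig_one (h : Fx φ) {A : Mt n} {x : Vc n} (hA : A *ᵥ x = x) : φ A *ᵥ x = x := by
  by_cases hx : x = 0
  · simp [hx]
  obtain ⟨g, hg⟩ := exists_dual1 hx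
  have := h.eig0 (m := 1) one_ne_zero (by simpa using hA) hg (c := 1) (by simp [h.fix x g hg])
  simpa using this

lemma Fx.eig_neg_one (h : Fx φ) {A : Mt n} {x : Vc n} (hA : A *ᵥ x = -x) : φ A *ᵥ x = -x := by
  by_cases hx : x = 0
  · simp [hx]
  obtain ⟨g, hg⟩ := exists_dual1 hx
  have := h.eig0 (m := -1) (by norm_num) (by simpa using hA) hg (c := -1) (by
    have := h.neg_fix (ro_idem hg)
    norm_num [this])
  norm_num at this; exact this

lemma Fx.trip (h : Fx φ) {D : Mt n} (hD : D * D * D = D) : φ D = D := by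
  have h2 : (1 - D * D) * (1 - D * D) = 1 - D * D := by
    simp only [mul_sub, sub_mul, mul_one, one_mul, ← mul_assoc, hD]; abel
  have h3 : D * (1 - D * D) + (1 - D * D) * D = 0 := by
    simp only [mul_sub, sub_mul, mul_one, one_mul, ← mul_assoc, hD]; abel
  have h4 := (anti_split h2 ((h.anti h2 D).1 h3)).1
  rw [mul_sub, mul_one, sub_eq_zero] at h4
  apply mat_ext; intro v
  have hDv : D *ᵥ (D *ᵥ (D *ᵥ v)) = D *ᵥ v := by
    rw [mulVec_mulVec, mulVec_mulVec, hD]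
  have e1 := h.eig_one (A := D) (x := D *ᵥ (D *ᵥ v) + D *ᵥ v) (by
    rw [mulVec_add, hDv]; abel)
  have e2 := h.eig_neg_one (A := D) (x := D *ᵥ (D *ᵥ v) - D *ᵥ v) (by
    rw [mulVec_sub, hDv]; abel)
  rw [mulVec_add] at e1
  rw [mulVec_sub] at e2
  rw [h4, ← mulVec_mulVec, ← mulVec_mulVec]
  have : (2:ℂ) • (φ D *ᵥ (D *ᵥ (D *ᵥ v))) = (2:ℂ) • (D *ᵥ v) := by
    linear_combination (norm := module) e1 + e2
  exact smul_right_injective _ (by norm_num) this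

end JP

namespace JP
variable {n : ℕ}
variable {φ : Mt n → Mt n}

lemma Fx.nil_ker (hn : 3 ≤ n) (h : Fx φ) {x0 f0 : Vc n} (hx : x0 ≠ 0) (hf : f0 ≠ 0)
    (h0 : f0 ⬝ᵥ x0 = 0) {z : Vc n} (hz : f0 ⬝ᵥ z = 0) : φ (ro x0 f0) *ᵥ z = 0 := by
  have k : ∀ z : Vc n, f0 ⬝ᵥ z = 0 → (∀ c : ℂ, z ≠ c • x0) → φ (ro x0 f0) *ᵥ z = 0 := by
    intro z hz hzx
    obtain ⟨g, h1, h2⟩ := exists_dual2 hx hzx 0 1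
    have hP := ro_idem h2
    have e := (anti_split hP ((h.anti hP (ro x0 f0)).1 (by
      rw [ro_mul_ro, ro_mul_ro, hz, h1]; simp))).1
    have := congrArg (fun X => X *ᵥ z) e
    simpa [← mulVec_mulVec, ro_mulVec, h2] using this
  by_cases hzx : ∀ c : ℂ, z ≠ c • x0
  · exact k z hz hzx
  push Not at hzx
  obtain ⟨c, rfl⟩ := hzx
  obtain ⟨p, hp⟩ := exists_dual1 hx
  obtain ⟨w, hw, h1, h2⟩ := exists_ker2 hn f0 p
  have hwx : ∀ d : ℂ, w ≠ d • x0 := by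
    rintro d rfl
    rw [dotProduct_smul, hp, smul_eq_mul, mul_one] at h2
    simp [h2] at hw
  have e1 := k w h1 hwx
  have e2 := k (c • x0 + w) (by rw [dotProduct_add, hz, h1, add_zero]) (by
    intro d hd
    exact hwx (d - c) (by rw [sub_smul, ← hd]; abel))
  rwa [mulVec_add, e1, add_zero] at e2

lemma Fx.nil_fix (hn : 3 ≤ n) (h : Fx φ) {x0 f0 : Vc n} (h0 : f0 ⬝ᵥ x0 = 0) :
    φ (ro x0 f0) = ro x0 f0 := by
  by_cases hx : x0 = 0
  · subst hx; simp [ro, h.zero]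
  by_cases hf : f0 = 0
  · subst hf; simp [ro, h.zero]
  have k1 := fun z hz => h.nil_ker hn hx hf h0 (z := z) hz
  have k2 : ∀ g : Vc n, g ⬝ᵥ x0 = 0 → g ᵥ* φ (ro x0 f0) = 0 := by
    intro g hg
    have := h.dual.nil_ker hn hf hx (by rw [dotProduct_comm, h0]) (z := g) (by rw [dotProduct_comm, hg])
    simpa [ro_transpose, mulVec_transpose] using this
  obtain ⟨z, hz⟩ := exists_dual1' hf
  obtain ⟨p, hp⟩ := exists_dual1 hx
  set B := φ (ro x0 f0) with hB
  have hb : B *ᵥ z = (p ⬝ᵥ (B *ᵥ z)) • x0 := by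
    apply vec_ext; intro g
    have := k2 (g - (g ⬝ᵥ x0) • p) (by simp [sub_dotProduct, smul_dotProduct, hp])
    have := congrArg (fun w => w ⬝ᵥ z) this
    simp only [vm_dot, sub_dotProduct, smul_dotProduct, zero_dotProduct, smul_eq_mul] at this
    rw [dotProduct_smul, smul_eq_mul]
    linear_combination this
  set c := p ⬝ᵥ (B *ᵥ z) with hc
  have hBc : B = c • ro x0 f0 := by
    apply mat_ext; intro v
    have := k1 (v - (f0 ⬝ᵥ v) • z) (by simp [dotProduct_sub, dotProduct_smul, hz])
    rw [mulVec_sub, mulVec_smul, hb, sub_eq_zero] at this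
    rw [this, smul_mulVec, ro_mulVec, smul_comm]
  have hc0 : c ≠ 0 := by
    rintro h1
    rw [h1, zero_smul] at hBc
    have := h.toPre.eq_zero hBc
    rw [ro_eq_zero] at this; tauto
  have hzx : ∀ c : ℂ, z ≠ c • x0 := by
    rintro c rfl
    rw [dotProduct_smul, h0] at hz; simp at hz
  obtain ⟨w, hw1, hw2⟩ := exists_dual2 hx hzx 2 0
  set D : Mt n := ro z w + (2⁻¹ : ℂ) • ro x0 f0 with hD
  have hD2 : D * D = ro z f0 + (2⁻¹ : ℂ) • ro x0 w := by
    simp only [hD, mul_add, add_mul, smul_mul_assoc, mul_smul_comm, ro_mul_ro, hw1, hw2, hz, h0]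
    module
  have hD3 : D * D * D = D := by
    rw [hD2]
    simp only [hD, mul_add, add_mul, smul_mul_assoc, mul_smul_comm, ro_mul_ro, hw1, hw2, hz, h0]
    module
  have hND : ro x0 f0 * D + D * ro x0 f0 = (2:ℂ) • (D * D) := by
    rw [hD2]
    simp only [hD, mul_add, add_mul, smul_mul_assoc, mul_smul_comm, ro_mul_ro, hw1, hw2, hz, h0]
    module
  have hD4 : (D * D) * (D * D) = D * D := by rw [← mul_assoc, hD3]
  have r : Rel (ro x0 f0) D := by
    unfold Rel; rw [hND, smul_mul_smul_comm, hD4, smul_smul]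
  have hDD : D * D ≠ 0 := by
    intro h0
    rw [h0, zero_mul] at hD3
    rw [← hD3] at hND
    simp at hND
    have := congrArg (fun X => X *ᵥ x0) hD3
    rw [hD] at this
    simp only [zero_mulVec, add_mulVec, smul_mulVec, ro_mulVec, hw1, ‹f0 ⬝ᵥ x0 = 0›] at this
    have h5 : (2:ℂ) • z = 0 := by simpa using this.symm
    exact hzx 0 (by rw [zero_smul]; exact (smul_eq_zero.1 h5).resolve_left (by norm_num))
  rw [h.pres, h.trip hD3, ← hB, hBc, Rel.comm, rel_smul_iff c hc0, add_comm (D * _), hND, smul_mul_smul_comm, hD4] at r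
  have : (4 * (c - 1)) • (D * D) = 0 := by
    linear_combination (norm := module) r
  have := (smul_eq_zero.1 this).resolve_right hDD
  have hc1 : c = 1 := by linear_combination this / 4
  rw [hBc, hc1, one_smul]

lemma Fx.smul_fix (hn : 3 ≤ n) (h : Fx φ) {x g : Vc n} (hg : g ⬝ᵥ x = 1) {l : ℂ} (hl : l ≠ 0) :
    φ (l • ro x g) = l • ro x g := by
  obtain ⟨hx, hg0⟩ := ne_zero_of_dot one_ne_zero hg
  obtain ⟨c, hc0, hc⟩ := h.smul_P hg hl
  obtain ⟨y, hy, hgy, -⟩ := exists_ker2 hn g g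
  have hyx : ∀ c : ℂ, y ≠ c • x := by
    rintro c rfl
    rw [dotProduct_smul, hg] at hgy
    simp at hgy; simp [hgy] at hy
  obtain ⟨k, hkx, hky⟩ := exists_dual2 hx hyx 0 1
  obtain ⟨d, hd0, hd⟩ := h.smul_P hky (l := -l) (neg_ne_zero.2 hl)
  set D : Mt n := l⁻¹ • (ro x g - ro y k) with hD
  have e1 := h.eig0 (A := D) (inv_ne_zero hl) (by
    simp [hD, smul_mulVec, sub_mulVec, ro_mulVec, hg, hkx]) hg (by rw [inv_inv, hc])
  have e2 := h.eig0 (A := D) (x := y) (m := -l⁻¹) (by simpa using hl) (by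
    simp [hD, smul_mulVec, sub_mulVec, ro_mulVec, hgy, hky]) hky (c := d) (by
      rw [inv_neg, inv_inv, hd])
  set B := φ D with hB
  have hQ : (ro x g + ro y k) * (ro x g + ro y k) = ro x g + ro y k := by
    simp only [mul_add, add_mul, ro_mul_ro, hg, hgy, hkx, hky]; module
  have hQ' := compl_idem hQ
  have a1 := (anti_split hQ' ((h.anti hQ' D).1 (by
    simp only [hD, mul_add, add_mul, sub_mul, mul_sub, mul_one, one_mul, smul_mul_assoc, mul_smul_comm, ro_mul_ro, hg, hgy, hkx, hky]; module))).1
  rw [← hB, mul_sub, mul_one, sub_eq_zero, mul_add, mul_ro, mul_ro, e1, e2, ro_smul_left, ro_smul_left] at a1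
  set a := c⁻¹ with ha
  set b := d⁻¹ with hb
  have r : Rel D (l • ro (x + y) (g - k)) := by
    unfold Rel
    simp only [hD, mul_add, add_mul, sub_mul, mul_sub, mul_one, one_mul, smul_mul_assoc, mul_smul_comm,
      ro_mul_ro, hg, hgy, hkx, hky, ro_add_left, ro_add_right, ro_sub_left, ro_sub_right, smul_add, smul_sub, smul_smul]
    field_simp
    module
  have hN : φ (l • ro (x + y) (g - k)) = l • ro (x + y) (g - k) := by
    rw [← ro_smul_left]
    apply h.nil_fix hn
    simp [sub_dotProduct, dotProduct_smul, dotProduct_add, hg, hgy, hkx, hky]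
  rw [h.pres, hN, ← hB, a1, rel_smul_iff l hl] at r
  have r1 := congrArg (fun X => g ⬝ᵥ (X *ᵥ x)) r
  have r2 := congrArg (fun X => g ⬝ᵥ (X *ᵥ y)) r
  simp [← mulVec_mulVec, smul_mulVec, add_mulVec, mulVec_add, mulVec_smul, ro_mulVec, dotProduct_add, dotProduct_smul,
    sub_dotProduct, hg, hgy, hkx, hky] at r1 r2
  have key : l * a = 1 := by
    have ha0 : a ≠ 0 := inv_ne_zero hc0
    by_cases hs : a + b = 0
    · have : b = -a := by linear_combination hs
      rw [this] at r1
      apply mul_left_cancel₀ ha0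
      linear_combination r1 / 4
    · exfalso
      have q : l * (a - b) = 1 := by
        apply mul_left_cancel₀ hs
        linear_combination -r2 / 2
      have q2 : b = a := by linear_combination r1 - (3 * a + b) * q
      rw [q2] at q; simp at q
  rw [hc]
  congr 1
  rw [ha] at key
  field_simp at key
  exact key.symm

lemma Fx.ro_fix (hn : 3 ≤ n) (h : Fx φ) (x f : Vc n) : φ (ro x f) = ro x f := by
  by_cases h0 : f ⬝ᵥ x = 0
  · exact h.nil_fix hn h0
  · have := h.smul_fix hn (x := x) (g := (f ⬝ᵥ x)⁻¹ • f) (by simp [smul_dotProduct, h0]) h0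
    rwa [ro_smul_right, smul_smul, mul_inv_cancel₀ h0, one_smul] at this

lemma Fx.eig (hn : 3 ≤ n) (h : Fx φ) {A : Mt n} {x : Vc n} {m : ℂ} (hm : m ≠ 0) (hA : A *ᵥ x = m • x) :
    φ A *ᵥ x = m • x := by
  by_cases hx : x = 0
  · simp [hx]
  obtain ⟨g, hg⟩ := exists_dual1 hx
  have := h.eig0 hm hA hg (h.smul_fix hn hg (inv_ne_zero hm))
  rwa [inv_inv] at this

lemma Fx.eig' (hn : 3 ≤ n) (h : Fx φ) {A : Mt n} {f : Vc n} {m : ℂ} (hm : m ≠ 0) (hA : f ᵥ* A = m • f) :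
    f ᵥ* φ A = m • f := by
  have := h.dual.eig hn (A := Aᵀ) hm (by rw [mulVec_transpose, hA])
  simpa [mulVec_transpose] using this

lemma Fx.strip (hn : 3 ≤ n) (h : Fx φ) {D : Mt n} (hD : D * D * D = D) {t : ℂ} (ht : t ≠ 0) : φ (t • D) = t • D := by
  have h2 : (1 - D * D) * (1 - D * D) = 1 - D * D := by
    simp only [mul_sub, sub_mul, mul_one, one_mul, ← mul_assoc, hD]; abel
  have h3 : (t • D) * (1 - D * D) + (1 - D * D) * (t • D) = 0 := by
    simp only [mul_sub, sub_mul, mul_one, one_mul, ← mul_assoc, hD, smul_mul_assoc, mul_smul_comm]; module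
  have h4 := (anti_split h2 ((h.anti h2 (t • D)).1 h3)).1
  rw [mul_sub, mul_one, sub_eq_zero] at h4
  apply mat_ext; intro v
  have hDv : D *ᵥ (D *ᵥ (D *ᵥ v)) = D *ᵥ v := by
    rw [mulVec_mulVec, mulVec_mulVec, hD]
  have e1 := h.eig hn (A := t • D) (x := D *ᵥ (D *ᵥ v) + D *ᵥ v) ht (by
    rw [smul_mulVec, mulVec_add, hDv]; module)
  have e2 := h.eig hn (A := t • D) (x := D *ᵥ (D *ᵥ v) - D *ᵥ v) (neg_ne_zero.2 ht) (by
    rw [smul_mulVec, mulVec_sub, hDv]; module)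
  rw [mulVec_add] at e1
  rw [mulVec_sub] at e2
  rw [h4, ← mulVec_mulVec, ← mulVec_mulVec, smul_mulVec]
  have : (2:ℂ) • (φ (t • D) *ᵥ (D *ᵥ (D *ᵥ v))) = (2:ℂ) • (t • D *ᵥ v) := by
    linear_combination (norm := module) e1 + e2
  exact smul_right_injective _ (by norm_num) this

end JP

namespace JP
variable {n : ℕ}
variable {φ : Mt n → Mt n}

lemma Fx.sro_fix (hn : 3 ≤ n) (h : Fx φ) (t : ℂ) (x f : Vc n) : φ (t • ro x f) = t • ro x f := by
  rw [← ro_smul_left]; exact h.ro_fix hn _ _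

lemma Fx.anti_fix (h : Fx φ) {R : Mt n} (hR : ∀ t : ℂ, t ≠ 0 → φ (t • R) = t • R) (A : Mt n) :
    A * R + R * A = 0 ↔ φ A * R + R * φ A = 0 := by
  have k : ∀ X : Mt n, X * R + R * X = 0 ↔ ∀ t : ℂ, t ≠ 0 → Rel X (t • R) := by
    intro X
    constructor
    · intro h0 t ht; exact rel_smul_of_zero t h0
    · intro h0
      exact rel_two one_ne_zero two_ne_zero (by norm_num) (h0 1 one_ne_zero) (h0 2 two_ne_zero)
  rw [k, k]
  refine forall_congr' fun t => forall_congr' fun ht => ?_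
  rw [h.pres, hR t ht]

lemma Fx.anti_ro (hn : 3 ≤ n) (h : Fx φ) (x f : Vc n) (A : Mt n) :
    A * ro x f + ro x f * A = 0 ↔ φ A * ro x f + ro x f * φ A = 0 :=
  h.anti_fix (fun t _ => h.sro_fix hn t x f) A

lemma Fx.F2 (hn : 3 ≤ n) (h : Fx φ) {A : Mt n} {x f : Vc n} (h0 : f ⬝ᵥ x = 0)
    (h2 : f ⬝ᵥ (A *ᵥ (A *ᵥ x)) = 0) (h1 : f ⬝ᵥ (A *ᵥ x) ≠ 0) :
    f ⬝ᵥ (φ A *ᵥ x) = f ⬝ᵥ (A *ᵥ x) := by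
  set a := f ⬝ᵥ (A *ᵥ x) with ha
  have ht : 2 / a ≠ 0 := div_ne_zero two_ne_zero h1
  have hf : f ≠ 0 := by
    rintro rfl; simp at ha; exact h1 ha
  have r : Rel A ((2 / a) • ro x f) := by
    rw [rel_smul_iff _ ht, mul_ro, ro_mul]
    simp only [mul_add, add_mul, ro_mul_ro, vm_dot, h0, h2, ← ha, smul_add, smul_smul]
    rw [div_mul_cancel₀ _ h1]; module
  rw [h.pres, h.sro_fix hn, rel_smul_iff _ ht] at r
  set B := φ A with hB
  set b := f ⬝ᵥ (B *ᵥ x) with hb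
  set M := B * ro x f + ro x f * B with hM
  have hfM : f ᵥ* M = b • f := by
    rw [hM, mul_ro, ro_mul, vecMul_add, vecMul_ro, vecMul_ro, h0, zero_smul, add_zero]
  have q : (2 / a) * (b * b) = 2 * b := by
    have := congrArg (fun X => f ᵥ* X) r
    simp only [vecMul_smul, ← vecMul_vecMul, hfM, smul_vecMul, smul_smul] at this
    have h3 : ((2 / a) * (b * b) - 2 * b) • f = 0 := by
      rw [sub_smul, this, sub_self]
    have := (smul_eq_zero.1 h3).resolve_right hf
    linear_combination this
  by_cases hb0 : b = 0
  · exfalso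
    have hMM : M * M = (f ⬝ᵥ (B *ᵥ (B *ᵥ x))) • ro x f := by
      rw [hM, mul_ro, ro_mul]
      simp only [mul_add, add_mul, ro_mul_ro, vm_dot, h0, ← hb, hb0]
      module
    set e := f ⬝ᵥ (B *ᵥ (B *ᵥ x))
    have hM2 : M = ((2 / a) * e / 2) • ro x f := by
      rw [hMM] at r
      have : (2:ℂ) • M = (2:ℂ) • ((2 / a) * e / 2) • ro x f := by
        rw [← r]; module
      exact smul_right_injective _ (by norm_num) this
    have hM3 : M * M = 0 := by
      rw [hM2, smul_mul_smul_comm, ro_mul_ro, h0]; simp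
    have hM0 : M = 0 := by
      rw [hM3, smul_zero] at r
      exact (smul_eq_zero.1 r.symm).resolve_left (by norm_num)
    have := (h.anti_ro hn x f A).2 hM0
    have := congrArg (fun X => f ᵥ* X) this
    rw [mul_ro, ro_mul] at this
    simp only [vecMul_add, vecMul_ro, h0, ← ha, vecMul_zero, zero_smul, add_zero] at this
    exact (smul_eq_zero.1 this).elim h1 hf
  · have : (2 / a) * b = 2 := by
      apply mul_right_cancel₀ hb0; linear_combination q
    field_simp at this
    exact this

lemma Fx.F2' (hn : 3 ≤ n) (h : Fx φ) {A : Mt n} {x : Vc n}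
    (h1 : A *ᵥ x ∉ Submodule.span ℂ {x, A *ᵥ (A *ᵥ x)}) :
    ∃ p q : ℂ, φ A *ᵥ x - A *ᵥ x = p • x + q • (A *ᵥ (A *ᵥ x)) := by
  suffices hs : φ A *ᵥ x - A *ᵥ x ∈ Submodule.span ℂ {x, A *ᵥ (A *ᵥ x)} by
    obtain ⟨p, q, e⟩ := Submodule.mem_span_pair.1 hs
    exact ⟨p, q, e.symm⟩
  by_contra h2
  obtain ⟨f, hf, hf1⟩ := exists_dual _ h2
  obtain ⟨g, hg, hg1⟩ := exists_dual _ h1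
  have m1 : x ∈ Submodule.span ℂ {x, A *ᵥ (A *ᵥ x)} := Submodule.subset_span (by simp)
  have m2 : A *ᵥ (A *ᵥ x) ∈ Submodule.span ℂ {x, A *ᵥ (A *ᵥ x)} := Submodule.subset_span (by simp)
  have e1 := h.F2 hn (A := A) (hg _ m1) (hg _ m2) (by rw [hg1]; norm_num)
  have e2 := h.F2 hn (A := A) (x := x) (f := f + (1 - f ⬝ᵥ (A *ᵥ x)) • g)
    (by simp [add_dotProduct, smul_dotProduct, hf _ m1, hg _ m1])
    (by rw [add_dotProduct, smul_dotProduct, hf _ m2, hg _ m2]; simp)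
    (by simp [add_dotProduct, smul_dotProduct, hg1])
  rw [dotProduct_sub] at hf1
  simp only [add_dotProduct, smul_dotProduct, e1] at e2
  have : f ⬝ᵥ φ A *ᵥ x = f ⬝ᵥ A *ᵥ x := by linear_combination e2
  rw [this] at hf1; simp at hf1

/-- 2-corner -/
lemma Fx.corner (hn : 3 ≤ n) (h : Fx φ) {y1 y f1 f : Vc n} {m : ℂ} (hm : m ≠ 0)
    (h11 : f1 ⬝ᵥ y1 = 1) (h1y : f1 ⬝ᵥ y = 0) (hf1 : f ⬝ᵥ y1 = 0) (hfy : f ⬝ᵥ y = 1) :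
    φ (m • (ro y1 f1 + ro y f) + ro y1 f) = m • (ro y1 f1 + ro y f) + ro y1 f := by
  set A := m • (ro y1 f1 + ro y f) + ro y1 f with hA
  have hQ : (ro y1 f1 + ro y f) * (ro y1 f1 + ro y f) = ro y1 f1 + ro y f := by
    simp only [mul_add, add_mul, ro_mul_ro, h11, h1y, hf1, hfy]; module
  set Q := ro y1 f1 + ro y f with hQd
  have hQ' := compl_idem hQ
  have hAQ : A * Q = A := by
    rw [hA, add_mul, smul_mul_assoc, hQ]
    simp only [hQd, mul_add, ro_mul_ro, h11, h1y, hf1, hfy]; module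
  have hQA : Q * A = A := by
    rw [hA, mul_add, mul_smul_comm, hQ]
    simp only [hQd, add_mul, ro_mul_ro, h11, h1y, hf1, hfy]; module
  obtain ⟨a1, a2⟩ := anti_split hQ' ((h.anti hQ' A).1 (by
    rw [mul_sub, sub_mul, mul_one, one_mul, hAQ, hQA]; abel))
  have e1 := h.eig hn (A := A) (x := y1) hm (by
    simp only [hA, hQd, add_mulVec, smul_mulVec, ro_mulVec, h11, hf1]; module)
  have e2 := h.eig' hn (A := A) (f := f) hm (by
    simp only [hA, hQd, vecMul_add, vecMul_smul, vecMul_ro, hf1, hfy]; module)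
  set B := φ A with hB
  rw [mul_sub, mul_one, sub_eq_zero] at a1
  rw [sub_mul, one_mul, sub_eq_zero] at a2
  set c := f1 ⬝ᵥ (B *ᵥ y) with hc
  have hBy : B *ᵥ y = c • y1 + m • y := by
    have : f ⬝ᵥ (B *ᵥ y) = m := by rw [← vm_dot, e2, smul_dotProduct, hfy, smul_eq_mul, mul_one]
    conv_lhs => rw [a2, ← mulVec_mulVec, hQd, add_mulVec, ro_mulVec, ro_mulVec, this, ← hc]
  have hBc : B = m • Q + c • ro y1 f := by
    rw [a1, hQd, mul_add, mul_ro, mul_ro, e1, hBy, ro_add_left, ro_smul_left, ro_smul_left, ro_smul_left]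
    module
  set E : Mt n := (2 * m)⁻¹ • ro y1 f + (2 * m) • ro y f1 with hE
  have hm2 : (2 * m)⁻¹ * (2 * m) = 1 := inv_mul_cancel₀ (mul_ne_zero two_ne_zero hm)
  have hm3 : (2 * m) * (2 * m)⁻¹ = 1 := mul_inv_cancel₀ (mul_ne_zero two_ne_zero hm)
  have hEE : E * E = Q := by
    rw [hE, hQd]
    simp only [mul_add, add_mul, smul_mul_assoc, mul_smul_comm, ro_mul_ro, h11, h1y, hf1, hfy, smul_add,
      smul_smul, mul_one, mul_zero, hm2, hm3]; module
  have hQE : Q * E = E := by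
    rw [hE, hQd]
    simp only [mul_add, add_mul, smul_mul_assoc, mul_smul_comm, ro_mul_ro, h11, h1y, hf1, hfy]; module
  have hEQ : E * Q = E := by
    rw [hE, hQd]
    simp only [mul_add, add_mul, smul_mul_assoc, mul_smul_comm, ro_mul_ro, h11, h1y, hf1, hfy]; module
  have hE3 : E * E * E = E := by rw [hEE, hQE]
  have hyE : ro y1 f * E + E * ro y1 f = (2 * m) • Q := by
    rw [hE, hQd]
    simp only [mul_add, add_mul, smul_mul_assoc, mul_smul_comm, ro_mul_ro, h11, h1y, hf1, hfy]; module
  have key : ∀ c : ℂ, (m • Q + c • ro y1 f) * E + E * (m • Q + c • ro y1 f) = (2 * m) • (E + c • Q) := by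
    intro c
    have : (m • Q + c • ro y1 f) * E + E * (m • Q + c • ro y1 f)
        = m • (Q * E) + m • (E * Q) + c • (ro y1 f * E + E * ro y1 f) := by
      simp only [mul_add, add_mul, smul_mul_assoc, mul_smul_comm]; module
    rw [this, hyE, hQE, hEQ]; module
  have hmi : (2 * m)⁻¹ ≠ 0 := inv_ne_zero (mul_ne_zero two_ne_zero hm)
  have sq : ∀ c : ℂ, (E + c • Q) * (E + c • Q) = (1 + c * c) • Q + (2 * c) • E := by
    intro c
    simp only [mul_add, add_mul, smul_mul_assoc, mul_smul_comm, hEE, hEQ, hQE, hQ]; module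
  have r : ∀ c : ℂ, Rel (m • Q + c • ro y1 f) ((2 * m)⁻¹ • E) ↔
      (1 + c * c) • Q + (2 * c) • E = (2:ℂ) • (E + c • Q) := by
    intro c
    rw [rel_smul_iff _ hmi, key, smul_mul_smul_comm, sq, smul_smul, smul_smul, ← mul_assoc, hm2, one_mul,
      mul_comm 2 (2 * m), mul_smul (2 * m) (2 : ℂ)]
    exact (smul_right_injective (Mt n) (mul_ne_zero two_ne_zero hm)).eq_iff
  have r1 := (r 1).2 (by module)
  rw [one_smul, ← hA, h.pres, h.strip hn hE3 hmi, ← hB, hBc, r] at r1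
  have := congrArg (fun X => f1 ⬝ᵥ (X *ᵥ y)) r1
  rw [hE, hQd] at this
  simp [add_mulVec, smul_mulVec, ro_mulVec, h11, h1y, hf1, hfy] at this
  have hc1 : c = 1 := this.resolve_right hm
  rw [hBc, hc1, one_smul, hA]

lemma Fx.F3 (hn : 3 ≤ n) (h : Fx φ) {A : Mt n} {y1 y : Vc n} {m : ℂ} (hm : m ≠ 0)
    (hy1 : y1 ≠ 0) (hA1 : A *ᵥ y1 = m • y1) (hA : A *ᵥ y = m • y + y1) :
    φ A *ᵥ y = A *ᵥ y := by
  have hyy : ∀ c : ℂ, y ≠ c • y1 := by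
    rintro c rfl
    rw [mulVec_smul, hA1] at hA
    apply hy1
    linear_combination (norm := module) -hA
  obtain ⟨f1, h11, h1y⟩ := exists_dual2 hy1 hyy 1 0
  obtain ⟨f, hf1, hfy⟩ := exists_dual2 hy1 hyy 0 1
  have B1 := h.eig hn hm hA1
  have hmi : m⁻¹ ≠ 0 := inv_ne_zero hm
  set z := y - m⁻¹ • y1 with hz
  -- the fixed matrices
  have fixD : ∀ f : Vc n, f ⬝ᵥ y1 = 0 → f ⬝ᵥ y = 1 →
      φ (m⁻¹ • (ro y1 f1 + ro z f)) = m⁻¹ • (ro y1 f1 + ro z f) := by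
    intro f hf1 hfy
    have := h.corner hn (y1 := (-(m⁻¹ * m⁻¹)) • y1) (y := y) (f1 := (-(m * m)) • f1) (f := f) hmi
      (by simp [smul_dotProduct, dotProduct_smul, h11]; field_simp) (by simp [smul_dotProduct, h1y])
      (by simp [dotProduct_smul, hf1]) hfy
    have e : m⁻¹ • (ro (-(m⁻¹ * m⁻¹) • y1) (-(m * m) • f1) + ro y f) + ro (-(m⁻¹ * m⁻¹) • y1) f
        = m⁻¹ • (ro y1 f1 + ro z f) := by
      rw [hz, ro_sub_left]
      simp only [ro_smul_left, ro_smul_right, smul_smul]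
      have : -(m * m) * -(m⁻¹ * m⁻¹) = 1 := by field_simp
      rw [this]; module
    rwa [e] at this
  have hAz : A *ᵥ z = m • y := by
    rw [hz, mulVec_sub, mulVec_smul, hA, hA1, smul_smul, inv_mul_cancel₀ hm]; module
  have relD : ∀ f : Vc n, f ⬝ᵥ y1 = 0 → f ⬝ᵥ y = 1 → Rel A (m⁻¹ • (ro y1 f1 + ro z f)) := by
    intro f hf1 hfy
    set D := m⁻¹ • (ro y1 f1 + ro z f) with hD
    set Q := ro y1 f1 + ro y f with hQd
    have hQ : Q * Q = Q := by
      simp only [hQd, mul_add, add_mul, ro_mul_ro, h11, h1y, hf1, hfy]; module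
    have hAD : A * D = Q := by
      rw [hD, mul_smul_comm, mul_add, mul_ro, mul_ro, hAz, hA1, ro_smul_left, ro_smul_left, ← smul_add, smul_smul,
        inv_mul_cancel₀ hm, one_smul]
    have f1z : f1 ⬝ᵥ z = -m⁻¹ := by simp [hz, dotProduct_sub, dotProduct_smul, h11, h1y]
    have fz : f ⬝ᵥ z = 1 := by simp [hz, dotProduct_sub, dotProduct_smul, hf1, hfy]
    have hQD : Q * D = D := by
      rw [hD, hQd]
      simp only [mul_add, add_mul, mul_smul_comm, ro_mul_ro, h11, hf1, f1z, fz]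
      rw [hz, ro_sub_left, ro_smul_left]; module
    have hDQ : D * Q = D := by
      rw [hD, hQd]
      simp only [mul_add, add_mul, smul_mul_assoc, ro_mul_ro, h11, hf1, h1y, hfy]
      module
    have hDAQ : D * A * Q = Q := by
      rw [mul_assoc, hQd, mul_add, mul_ro, mul_ro, hA1, hA, hD]
      have e : m⁻¹ • (ro y1 f1 + ro z f) * (ro (m • y1) f1 + ro (m • y + y1) f)
          = (m⁻¹ * m) • ro y1 f1 + m⁻¹ • ro y1 f + (m⁻¹ * m) • ro z f := by
        simp only [mul_add, add_mul, smul_mul_assoc, ro_mul_ro, h11, hf1, h1y, hfy, ro_add_left, ro_smul_left,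
          mul_smul_comm]
        module
      rw [e, inv_mul_cancel₀ hm, hz, ro_sub_left, ro_smul_left]
      module
    unfold Rel
    rw [hAD]
    have e : (Q + D * A) * (Q + D * A) = Q * Q + (Q * D) * A + D * A * Q + D * (A * D) * A := by noncomm_ring
    rw [e, hQ, hQD, hDAQ, hAD, hDQ]; module
  set B := φ A with hB
  have relB : ∀ f : Vc n, f ⬝ᵥ y1 = 0 → f ⬝ᵥ y = 1 → Rel B (m⁻¹ • (ro y1 f1 + ro z f)) := by
    intro f hf1 hfy
    rw [← fixD f hf1 hfy, ← h.pres]; exact relD f hf1 hfy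
  have k0 : ∀ f0 : Vc n, f0 ⬝ᵥ y1 = 0 → f0 ⬝ᵥ y = 0 → f0 ⬝ᵥ (B *ᵥ y) = 0 := by
    intro f0 h01 h0y
    by_cases hf0 : f0 = 0
    · simp [hf0]
    have r0 := relB f hf1 hfy
    have r1 := relB (f + f0) (by simp [add_dotProduct, hf1, h01]) (by simp [add_dotProduct, hfy, h0y])
    have r2 := relB (f - f0) (by simp [sub_dotProduct, hf1, h01]) (by simp [sub_dotProduct, hfy, h0y])
    rw [rel_smul_iff _ hmi] at r0 r1 r2
    set F := B * ro z f0 + ro z f0 * B with hF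
    set G := B * (ro y1 f1 + ro z f) + (ro y1 f1 + ro z f) * B with hG
    have g1 : B * (ro y1 f1 + ro z (f + f0)) + (ro y1 f1 + ro z (f + f0)) * B = G + F := by
      rw [ro_add_right]; simp only [hG, hF]; noncomm_ring
    have g2 : B * (ro y1 f1 + ro z (f - f0)) + (ro y1 f1 + ro z (f - f0)) * B = G - F := by
      rw [ro_sub_right]; simp only [hG, hF]; noncomm_ring
    rw [g1] at r1
    rw [g2] at r2
    have e1 : (G + F) * (G + F) = G * G + G * F + F * G + F * F := by noncomm_ring
    have e2 : (G - F) * (G - F) = G * G - G * F - F * G + F * F := by noncomm_ring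
    rw [e1] at r1
    rw [e2] at r2
    have hFF : (2 * m⁻¹) • (F * F) = 0 := by
      linear_combination (norm := module) r1 + r2 - (2:ℂ) • r0
    have hFF := (smul_eq_zero.1 hFF).resolve_left (mul_ne_zero two_ne_zero hmi)
    have hz0 : f0 ⬝ᵥ z = 0 := by simp [hz, dotProduct_sub, dotProduct_smul, h01, h0y]
    have fF : f0 ᵥ* F = (f0 ⬝ᵥ (B *ᵥ z)) • f0 := by
      rw [hF, mul_ro, ro_mul, vecMul_add, vecMul_ro, vecMul_ro, hz0]; simp
    have := congrArg (fun X => f0 ᵥ* X) hFF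
    simp only [← vecMul_vecMul, fF, smul_vecMul, vecMul_zero, smul_smul] at this
    have := (smul_eq_zero.1 this).resolve_right hf0
    have := mul_self_eq_zero.1 this
    simpa [hz, mulVec_sub, mulVec_smul, dotProduct_sub, dotProduct_smul, B1, h01] using this
  set p := f ⬝ᵥ (B *ᵥ y) with hp
  set b := f1 ⬝ᵥ (B *ᵥ y) with hb
  have hBy : B *ᵥ y = p • y + b • y1 := by
    apply vec_ext; intro g
    have := k0 (g - (g ⬝ᵥ y) • f - (g ⬝ᵥ y1) • f1)
      (by simp [sub_dotProduct, smul_dotProduct, h11, h1y, hf1, hfy])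
      (by simp [sub_dotProduct, smul_dotProduct, h11, h1y, hf1, hfy])
    simp only [sub_dotProduct, smul_dotProduct, ← hp, ← hb, smul_eq_mul] at this
    simp only [dotProduct_add, dotProduct_smul, smul_eq_mul]
    linear_combination this
  have r0 := relB f hf1 hfy
  rw [rel_smul_iff _ hmi] at r0
  set T := B * (ro y1 f1 + ro z f) + (ro y1 f1 + ro z f) * B with hT
  have T1 : T *ᵥ y1 = (2 * m) • y1 := by
    simp only [hT, add_mulVec, ← mulVec_mulVec, ro_mulVec, mulVec_add, mulVec_smul, B1, h11, hf1, dotProduct_smul,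
      dotProduct_add, mulVec_zero, zero_smul, one_smul, smul_eq_mul]
    module
  have Ty : T *ᵥ y = (2 * p) • y + (2 * b - 1 - p * m⁻¹) • y1 := by
    have hmm : m⁻¹ • m • y1 = y1 := by rw [smul_smul, inv_mul_cancel₀ hm, one_smul]
    simp only [hT, add_mulVec, ← mulVec_mulVec, ro_mulVec, mulVec_add, mulVec_smul, B1, h11, h1y, hfy, hf1,
      dotProduct_smul, hBy, mulVec_sub, hz,
      dotProduct_add, mulVec_zero, zero_smul, one_smul, smul_eq_mul, hmm]
    module
  have r1 := congrArg (fun X => X *ᵥ y) r0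
  simp only [smul_mulVec, ← mulVec_mulVec, Ty, mulVec_add, mulVec_smul, T1] at r1
  have s1 := congrArg (fun v => f ⬝ᵥ v) r1
  have s2 := congrArg (fun v => f1 ⬝ᵥ v) r1
  simp [dotProduct_add, dotProduct_smul, h11, h1y, hf1, hfy] at s1 s2
  by_cases hp0 : p = 0
  · exfalso
    rw [hp0, zero_smul, zero_add] at hBy
    set y' := y - (b * m⁻¹) • y1 with hy'
    have hBy' : B *ᵥ y' = 0 := by
      rw [hy', mulVec_sub, mulVec_smul, hBy, B1, smul_smul, mul_assoc, inv_mul_cancel₀ hm]; simp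
    have hy'0 : y' ≠ 0 := by
      intro e
      exact hyy _ (sub_eq_zero.1 e)
    have hdet : B.det = 0 := exists_mulVec_eq_zero_iff.1 ⟨y', hy'0, hBy'⟩
    obtain ⟨g, hg0, hg⟩ := exists_vecMul_eq_zero_iff.2 hdet
    have e := (h.anti_ro hn y' g A).2 (by
      rw [← hB, mul_ro, ro_mul, hBy', hg]; simp [ro])
    obtain ⟨v, hv⟩ := exists_dual1' hg0
    have e2 := congrArg (fun X => X *ᵥ v) e
    have hAy' : A *ᵥ y' = m • y' + y1 := by
      rw [hy', mulVec_sub, mulVec_smul, hA, hA1]; module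
    simp only [mul_ro, ro_mul, add_mulVec, ro_mulVec, hv, hAy', zero_mulVec, one_smul] at e2
    set k := (g ᵥ* A) ⬝ᵥ v
    have e3 : f ⬝ᵥ y' = 1 := by simp [hy', dotProduct_sub, dotProduct_smul, hfy, hf1]
    have e4 := congrArg (fun w => f ⬝ᵥ w) e2
    simp [dotProduct_add, dotProduct_smul, e3, hf1] at e4
    apply hy1
    have e5 : (m + k) • y' = 0 := by rw [e4, zero_smul]
    linear_combination (norm := module) e2 - e5
  · have hpm : p = m := by
      field_simp at s1; exact s1
    rw [hpm] at s2 hBy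
    have hb1 : b = 1 := by
      field_simp at s2
      linear_combination s2 / 2
    rw [hBy, hb1, hA, one_smul]

end JP

namespace JP
variable {n : ℕ}
variable {φ : Mt n → Mt n}

lemma indep3 {N : Mt n} {X0 X1 X2 : Vc n} (h0 : N *ᵥ X0 = X1) (h1 : N *ᵥ X1 = X2) (h2 : N *ᵥ X2 = 0)
    (hX : X2 ≠ 0) {a b c : ℂ} (h : a • X0 + b • X1 + c • X2 = 0) : a = 0 ∧ b = 0 ∧ c = 0 := by
  have e1 := congrArg (fun v => N *ᵥ v) h
  simp only [mulVec_add, mulVec_smul, h0, h1, h2, mulVec_zero, smul_zero, add_zero] at e1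
  have e2 := congrArg (fun v => N *ᵥ v) e1
  simp only [mulVec_add, mulVec_smul, h0, h1, h2, mulVec_zero, smul_zero, add_zero] at e2
  have ha := (smul_eq_zero.1 e2).resolve_right hX
  rw [ha, zero_smul, zero_add] at e1 h
  have hb := (smul_eq_zero.1 e1).resolve_right hX
  rw [hb, zero_smul, zero_add] at h
  exact ⟨ha, hb, (smul_eq_zero.1 h).resolve_right hX⟩

lemma Fx.gen_ne (hn : 3 ≤ n) (h : Fx φ) {A : Mt n} {m : ℂ} (hm : m ≠ 0) :
    ∀ (j : ℕ) (x : Vc n), (A - m • 1) ^ j *ᵥ x = 0 → φ A *ᵥ x = A *ᵥ x := by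
  set N := A - m • (1 : Mt n) with hN
  have hAv : ∀ v, A *ᵥ v = m • v + N *ᵥ v := by
    intro v; rw [hN, sub_mulVec, smul_mulVec, one_mulVec]; abel
  have pw : ∀ (k : ℕ) (v : Vc n), N ^ (k + 1) *ᵥ v = N ^ k *ᵥ (N *ᵥ v) := by
    intro k v; rw [pow_succ, mulVec_mulVec]
  intro j
  induction j with
  | zero => intro x hx; simp at hx; simp [hx]
  | succ j ih =>
    intro x hx
    by_cases hx' : N ^ j *ᵥ x = 0
    · exact ih x hx'
    match j, ih, hx, hx' with
    | 0, ih, hx, hx' =>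
      rw [zero_add, pow_one] at hx
      have := hAv x
      rw [hx, add_zero] at this
      rw [h.eig hn hm this, this]
    | 1, ih, hx, hx' =>
      rw [pow_one] at hx'
      rw [pw, pow_one] at hx
      refine h.F3 hn hm hx' ?_ (hAv x)
      rw [hAv, hx, add_zero]
    | k + 2, ih, hx, hx' =>
      set T := N ^ k with hT
      have hNT : ∀ v, T *ᵥ (N *ᵥ v) = N *ᵥ (T *ᵥ v) := by
        intro v; rw [mulVec_mulVec, mulVec_mulVec, hT, ← pow_succ, ← pow_succ']
      have hTA : ∀ v, T *ᵥ (A *ᵥ v) = A *ᵥ (T *ᵥ v) := by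
        intro v; rw [hAv, mulVec_add, mulVec_smul, hNT, ← hAv]
      obtain ⟨X0, hX0⟩ : ∃ X0, X0 = T *ᵥ x := ⟨_, rfl⟩
      obtain ⟨X1, hX1⟩ : ∃ X1, N *ᵥ X0 = X1 := ⟨_, rfl⟩
      obtain ⟨X2, hX2⟩ : ∃ X2, N *ᵥ X1 = X2 := ⟨_, rfl⟩
      have hne : X2 ≠ 0 := by
        rw [← hX2, ← hX1, hX0, ← hNT, ← hNT]
        rwa [pw, pw] at hx'
      have hX3 : N *ᵥ X2 = 0 := by
        rw [← hX2, ← hX1, hX0, ← hNT, ← hNT, ← hNT]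
        rwa [pw, pw, pw] at hx
      have A0 : A *ᵥ X0 = m • X0 + X1 := by rw [hAv, hX1]
      have A1 : A *ᵥ X1 = m • X1 + X2 := by rw [hAv, hX2]
      have A2 : A *ᵥ X2 = m • X2 := by rw [hAv, hX3, add_zero]
      have TN : T *ᵥ (N *ᵥ x) = X1 := by rw [hNT, ← hX0, hX1]
      have ihN : φ A *ᵥ (N *ᵥ x) = A *ᵥ (N *ᵥ x) := ih _ (by rwa [pw] at hx)
      have ind := fun (a b c : ℂ) => indep3 (a := a) (b := b) (c := c) hX1 hX2 hX3 hne
      have key : ∀ s : ℂ, ∃ p q : ℂ, φ A *ᵥ x - A *ᵥ x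
          = p • (x + s • N *ᵥ x) + q • (A *ᵥ (A *ᵥ (x + s • N *ᵥ x))) := by
        intro s
        obtain ⟨p, q, e⟩ := h.F2' hn (A := A) (x := x + s • N *ᵥ x) (by
          intro hmem
          obtain ⟨a, b, e⟩ := Submodule.mem_span_pair.1 hmem
          have e1 := congrArg (fun v => T *ᵥ v) e
          simp only [mulVec_add, mulVec_smul, hTA, TN, ← hX0, A0, A1, A2] at e1
          obtain ⟨i1, i2, i3⟩ := ind (a + b * m ^ 2 - m) (s * a + 2 * m * b + s * b * m ^ 2 - 1 - s * m)
            (b * (1 + 2 * m * s) - s) (by linear_combination (norm := module) e1)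
          have hb : 2 * m * b = 1 := by linear_combination i2 - s * i1
          have : (1 : ℂ) = 0 := by linear_combination 2 * m * i3 - (1 + 2 * m * s) * hb
          exact one_ne_zero this)
        refine ⟨p, q, ?_⟩
        rw [← e, mulVec_add, mulVec_add, mulVec_smul, mulVec_smul, ihN]; abel
      obtain ⟨p, q, e⟩ := key 0
      have sub : ∀ s : ℂ, s ≠ 0 → ∃ q' : ℂ, p + q * m ^ 2 = 4 * m ^ 2 * q' ∧ q = q' * (1 + 2 * m * s) := by
        intro s hs
        obtain ⟨p', q', e'⟩ := key s
        rw [e] at e'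
        have e1 := congrArg (fun v => T *ᵥ v) e'
        simp only [mulVec_add, mulVec_smul, hTA, TN, ← hX0, A0, A1, A2] at e1
        obtain ⟨i1, i2, i3⟩ := ind (p + q * m ^ 2 - p' - q' * m ^ 2)
          (2 * m * q - p' * s - q' * (2 * m + s * m ^ 2))
          (q - q' * (1 + 2 * m * s)) (by linear_combination (norm := module) e1)
        refine ⟨q', ?_, by linear_combination i3⟩
        apply mul_left_cancel₀ hs
        linear_combination - i2 + s * i1 + 2 * m * i3
      obtain ⟨a, a1, a2⟩ := sub 1 one_ne_zero
      obtain ⟨b, b1, b2⟩ := sub (-1) (by norm_num)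
      have hab : a = b := by
        have : 4 * m ^ 2 * (a - b) = 0 := by linear_combination b1 - a1
        have := (mul_eq_zero.1 this).resolve_left (by simpa using hm)
        linear_combination this
      have ha : a = 0 := by
        have : 4 * m * a = 0 := by rw [← hab] at b2; linear_combination b2 - a2
        exact (mul_eq_zero.1 this).resolve_left (by simpa using hm)
      have hq : q = 0 := by rw [a2, ha, zero_mul]
      have hp : p = 0 := by rw [hq, ha] at a1; linear_combination a1
      rw [hp, hq] at e
      simpa [sub_eq_zero] using e

lemma Fx.gen_zero_top (hn : 3 ≤ n) (h : Fx φ) {A : Mt n} {K : ℕ}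
    (hK : ∀ (j : ℕ) (x : Vc n), A ^ j *ᵥ x = 0 → A ^ (K + 1) *ᵥ x = 0) {y : Vc n}
    (hy : A ^ (K + 1) *ᵥ y = 0) (hy0 : A ^ K *ᵥ y ≠ 0) : φ A *ᵥ y = A *ᵥ y := by
  have pv : ∀ (i j : ℕ) (v : Vc n), A ^ i *ᵥ (A ^ j *ᵥ v) = A ^ (i + j) *ᵥ v := by
    intro i j v; rw [mulVec_mulVec, pow_add]
  have hbig : ∀ i, K < i → A ^ i *ᵥ y = 0 := by
    intro i hi
    obtain ⟨d, rfl⟩ := Nat.exists_eq_add_of_le' hi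
    rw [← pv, hy, mulVec_zero]
  -- functional
  have hf0 : ∃ f : Vc n, f ᵥ* A ^ (K + 1) = 0 ∧ f ⬝ᵥ (A ^ K *ᵥ y) = 1 := by
    obtain ⟨f, hf, hf1⟩ := exists_dual (LinearMap.range (toLin' (A ^ (K + 1)))) (v := A ^ K *ᵥ y) (by
      rintro ⟨u, hu⟩
      rw [toLin'_apply] at hu
      have h1 : A ^ (K + 1 + (K + 1)) *ᵥ u = 0 := by
        rw [← pv, hu, pv]; exact hbig _ (by omega)
      rw [hK _ _ h1] at hu
      exact hy0 hu.symm)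
    refine ⟨f, ?_, hf1⟩
    apply vec_ext'; intro v
    rw [vm_dot, zero_dotProduct]
    exact hf _ ⟨v, by rw [toLin'_apply]⟩
  have hf : ∀ r, r ≤ K → ∃ f : Vc n, f ᵥ* A ^ (K + 1) = 0 ∧ f ⬝ᵥ (A ^ K *ᵥ y) = 1 ∧
      ∀ i, i < K → K ≤ i + r → f ⬝ᵥ (A ^ i *ᵥ y) = 0 := by
    intro r
    induction r with
    | zero =>
      intro _
      obtain ⟨f, h1, h2⟩ := hf0
      exact ⟨f, h1, h2, fun i hi hi' => by omega⟩
    | succ r ih =>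
      intro hr
      obtain ⟨f, h1, h2, h3⟩ := ih (by omega)
      refine ⟨f - (f ⬝ᵥ (A ^ (K - (r + 1)) *ᵥ y)) • (f ᵥ* A ^ (r + 1)), ?_, ?_, ?_⟩
      · rw [sub_vecMul, smul_vecMul, vecMul_vecMul, ← pow_add, add_comm (r + 1) (K + 1), pow_add _ (K + 1) (r + 1), ← vecMul_vecMul, h1]
        simp
      · rw [sub_dotProduct, smul_dotProduct, vm_dot, pv, hbig (r + 1 + K) (by omega), h2]; simp
      · intro i hi hir
        rw [sub_dotProduct, smul_dotProduct, vm_dot, pv]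
        rcases Nat.lt_or_ge K (i + (r + 1)) with h4 | h4
        · rw [h3 i hi (by omega), hbig (r + 1 + i) (by omega)]; simp
        · have h5 : i = K - (r + 1) := by omega
          have h6 : r + 1 + i = K := by omega
          rw [h6, h2, h5]; simp
  obtain ⟨f, f1, f2, f3⟩ := hf K le_rfl
  have f4 : ∀ i, i ≠ K → f ⬝ᵥ (A ^ i *ᵥ y) = 0 := by
    intro i hi
    rcases Nat.lt_or_gt_of_ne hi with h1 | h1
    · exact f3 i h1 (by omega)
    · rw [hbig i h1, dotProduct_zero]
  set e : ℕ → Vc n := fun i => A ^ i *ᵥ y with he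
  set g : ℕ → Vc n := fun i => f ᵥ* A ^ (K - i) with hg
  have hge : ∀ i j, i ≤ K → j ≤ K → g i ⬝ᵥ e j = if i = j then 1 else 0 := by
    intro i j hi hj
    simp only [hg, he]
    rw [vm_dot, pv]
    split_ifs with hij
    · rw [show K - i + j = K by omega, f2]
    · exact f4 _ (by omega)
  set D : Mt n := ∑ i ∈ Finset.range (K + 1), (-1 : ℂ) ^ i • ro (e i) (g i) with hD
  have De : ∀ j, j ≤ K → D *ᵥ e j = (-1 : ℂ) ^ j • e j := by
    intro j hj
    rw [hD, sum_mulVec, Finset.sum_eq_single j]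
    · rw [smul_mulVec, ro_mulVec, hge j j hj hj]; simp
    · intro i hi hij
      rw [smul_mulVec, ro_mulVec, hge i j (by simpa [Nat.lt_succ_iff] using hi) hj, if_neg hij]; simp
    · intro hj'; simp at hj'; omega
  have hD3 : D * D * D = D := by
    conv_rhs => rw [hD]
    conv_lhs => rhs; rw [hD]
    rw [Finset.mul_sum]
    refine Finset.sum_congr rfl fun i hi => ?_
    have hi' : i ≤ K := by simpa [Nat.lt_succ_iff] using hi
    rw [mul_smul_comm, mul_ro, ← mulVec_mulVec, De i hi', mulVec_smul, De i hi', smul_smul, ← mul_pow]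
    simp
  have hAD : A * D + D * A = 0 := by
    have h1 : A * D = ∑ i ∈ Finset.range K, (-1 : ℂ) ^ i • ro (e (i + 1)) (g i) := by
      rw [hD, Finset.mul_sum, Finset.sum_range_succ]
      have eA : ∀ i, A *ᵥ e i = e (i + 1) := by
        intro i; simp only [he]; rw [mulVec_mulVec, pow_succ']
      have : e (K + 1) = 0 := hy
      simp only [mul_smul_comm, mul_ro, eA, this]
      simp [ro]
    have h2 : D * A = ∑ i ∈ Finset.range K, (-1 : ℂ) ^ (i + 1) • ro (e (i + 1)) (g i) := by
      rw [hD, Finset.sum_mul, Finset.sum_range_succ']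
      have g0 : g 0 ᵥ* A = 0 := by
        simp only [hg]; rw [vecMul_vecMul, ← pow_succ]; simpa using f1
      simp only [smul_mul_assoc, ro_mul, g0]
      have : (-1 : ℂ) ^ 0 • ro (e 0) 0 = 0 := by simp [ro]
      rw [this, add_zero]
      refine Finset.sum_congr rfl fun i hi => ?_
      have hi' : i < K := by simpa using hi
      congr 2
      simp only [hg]
      rw [vecMul_vecMul, ← pow_succ]
      congr 2; omega
    rw [h1, h2, ← Finset.sum_add_distrib]
    refine Finset.sum_eq_zero fun i _ => ?_
    rw [pow_succ]; module
  have hBD := (h.anti_fix (fun t ht => h.strip hn hD3 ht) A).1 hAD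
  have hy1 := congrArg (fun X => X *ᵥ y) hBD
  have e0 : e 0 = y := by simp [he]
  have Dy : D *ᵥ y = y := by
    have := De 0 (by omega); rw [e0] at this; simpa using this
  simp only [add_mulVec, ← mulVec_mulVec, Dy, zero_mulVec] at hy1
  rcases Nat.eq_zero_or_pos K with hK0 | hKp
  · have hD0 : ∀ v, D *ᵥ v = (f ⬝ᵥ v) • y := by
      intro v
      subst hK0
      rw [hD]; simp [he, hg, ro_mulVec]
    rw [hD0] at hy1
    subst hK0
    simp at f2
    have := congrArg (fun v => f ⬝ᵥ v) hy1
    simp [dotProduct_add, dotProduct_smul, f2] at this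
    rw [this, zero_smul, add_zero] at hy1
    simp at hy
    rw [hy1, hy]
  · obtain ⟨p, q, e'⟩ := h.F2' hn (A := A) (x := y) (by
      intro hmem
      obtain ⟨a, b, e1⟩ := Submodule.mem_span_pair.1 hmem
      have e2 : A *ᵥ (A *ᵥ y) = A ^ 2 *ᵥ y := by rw [mulVec_mulVec, pow_two]
      have e3 : A *ᵥ y = A ^ 1 *ᵥ y := by rw [pow_one]
      rw [e2, e3] at e1
      have e4 := congrArg (fun v => A ^ K *ᵥ v) e1
      simp only [mulVec_add, mulVec_smul, pv, hbig (K + 2) (by omega), hbig (K + 1) (by omega), smul_zero, add_zero] at e4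
      have ha := (smul_eq_zero.1 e4).resolve_right hy0
      have e5 := congrArg (fun v => A ^ (K - 1) *ᵥ v) e1
      simp only [ha, zero_smul, zero_add, mulVec_smul, pv] at e5
      rw [hbig _ (by omega), show K - 1 + 1 = K by omega, smul_zero] at e5
      exact hy0 e5.symm)
    have DA : D *ᵥ (A *ᵥ y) = - (A *ᵥ y) := by
      have := De 1 hKp
      simpa [he] using this
    have DAA : D *ᵥ (A *ᵥ (A *ᵥ y)) = A *ᵥ (A *ᵥ y) := by
      have e2 : A *ᵥ (A *ᵥ y) = e 2 := by simp only [he]; rw [mulVec_mulVec, pow_two]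
      rw [e2]
      rcases Nat.lt_or_ge K 2 with h2 | h2
      · have : e 2 = 0 := hbig 2 h2
        rw [this, mulVec_zero]
      · have := De 2 h2
        simpa using this
    have hB : φ A *ᵥ y = A *ᵥ y + (p • y + q • A *ᵥ (A *ᵥ y)) := by rw [← e']; abel
    rw [hB] at hy1
    simp only [mulVec_add, mulVec_smul, Dy, DA, DAA] at hy1
    have : (2:ℂ) • (p • y + q • A *ᵥ (A *ᵥ y)) = 0 := by
      linear_combination (norm := module) hy1
    rw [hB, (smul_eq_zero.1 this).resolve_left (by norm_num), add_zero]

lemma exists_max (A : Mt n) : ∃ k : ℕ, ∀ (j : ℕ) (x : Vc n), A ^ j *ᵥ x = 0 → A ^ k *ᵥ x = 0 := by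
  refine ⟨Module.finrank ℂ (Vc n), fun j x hx => ?_⟩
  have h1 : x ∈ LinearMap.ker ((toLin' A) ^ j) := by
    rw [LinearMap.mem_ker, ← toLin'_pow, toLin'_apply, hx]
  have := Module.End.ker_pow_le_ker_pow_finrank (toLin' A) j h1
  rwa [LinearMap.mem_ker, ← toLin'_pow, toLin'_apply] at this

lemma Fx.gen_zero (hn : 3 ≤ n) (h : Fx φ) {A : Mt n} (j : ℕ) (x : Vc n) (hx : A ^ j *ᵥ x = 0) :
    φ A *ᵥ x = A *ᵥ x := by
  classical
  have hex := exists_max A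
  have hk := Nat.find_spec hex
  have hmin := fun m => Nat.find_min hex (m := m)
  generalize Nat.find hex = k at hk hmin
  cases k with
  | zero =>
    have := hk j x hx
    simp at this; simp [this]
  | succ K =>
    have := hmin K (by omega)
    push Not at this
    obtain ⟨i, y, hy, hy0⟩ := this
    have hyK := hk _ _ hy
    have hxK := hk _ _ hx
    by_cases hx0 : A ^ K *ᵥ x = 0
    · have e1 := h.gen_zero_top hn hk hyK hy0
      have e2 := h.gen_zero_top hn hk (y := x + y) (by rw [mulVec_add, hxK, hyK, add_zero])
        (by rwa [mulVec_add, hx0, zero_add])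
      rw [mulVec_add, mulVec_add, e1] at e2
      exact add_right_cancel e2
    · exact h.gen_zero_top hn hk hxK hx0

theorem endgame (hn : 3 ≤ n) : ∀ φ : Mt n → Mt n, Good φ → (∀ P, R1 P → φ P = P) → ∀ A, φ A = A := by
  intro φ hφ hfix A
  have h : Fx φ := ⟨hφ, fun x f hf => hfix _ ⟨x, f, hf, rfl⟩⟩
  have htop : (⊤ : Submodule ℂ (Vc n)) ≤ LinearMap.ker (toLin' (φ A - A)) := by
    rw [← Module.End.iSup_maxGenEigenspace_eq_top (toLin' A)]
    refine iSup_le fun m x hx => ?_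
    rw [Module.End.mem_maxGenEigenspace] at hx
    obtain ⟨k, hk⟩ := hx
    have e : toLin' A - m • 1 = toLin' (A - m • 1) := by
      rw [map_sub, map_smul, toLin'_one]; rfl
    rw [e, ← toLin'_pow, toLin'_apply] at hk
    rw [LinearMap.mem_ker, toLin'_apply, sub_mulVec, sub_eq_zero]
    by_cases hm : m = 0
    · rw [hm, zero_smul, sub_zero] at hk
      exact h.gen_zero hn k x hk
    · exact h.gen_ne hn hm k x hk
  apply mat_ext; intro v
  have := htop (Submodule.mem_top (x := v))
  rwa [LinearMap.mem_ker, toLin'_apply, sub_mulVec, sub_eq_zero] at this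

end JP

theorem stmt_1 {n : ℕ} (hn : 3 ≤ n)
    (φ : Matrix (Fin n) (Fin n) ℂ → Matrix (Fin n) (Fin n) ℂ)
    (hrange : ∀ P : Matrix (Fin n) (Fin n) ℂ,
      ((P * P = P ∧ P ≠ 0) ∨ (P * P = -P ∧ P ≠ 0)) → ∃ A, φ A = P)
    (hpres : ∀ A B : Matrix (Fin n) (Fin n) ℂ,
      IsIdempotentElem ((2⁻¹ : ℂ) • (A * B + B * A)) ↔
        IsIdempotentElem ((2⁻¹ : ℂ) • (φ A * φ B + φ B * φ A))) :
    ∃ (σ : ℂ ≃+* ℂ) (T : Matrix (Fin n) (Fin n) ℂ) (lam : ℂ),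
      IsUnit T ∧ (lam = 1 ∨ lam = -1) ∧
      ((∀ M : Matrix (Fin n) (Fin n) ℂ, φ M = lam • (T * M.map ⇑σ * T⁻¹)) ∨
       (∀ M : Matrix (Fin n) (Fin n) ℂ, φ M = lam • (T * (M.map ⇑σ)ᵀ * T⁻¹))) :=
  JP.assemble3 hn (JP.endgame hn) φ hrange hpres
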